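/- arXiv:2510.06392 — 7 statements merged into one kernel-verified Lean document; each statement's English description precedes it below -/
import Mathlib

section
/- Let G be a graph with minimum degree at least three and let F be a forest contained in G (as a subgraph). If the graph G/E(F) obtained by contracting all edges of F is simple and 3-connected, then G is 3-connected. -/
open SimpleGraph

/-- A graph is `k`-connected if it has more than `k` vertices and the deletion of any set of
fewer than `k` vertices leaves a connected graph (equivalently, there is no vertex cut of size
less than `k`). -/
def KConnected {V : Type*} (k : ℕ) (G : SimpleGraph V) : Prop :=
  k < Nat.card V ∧ ∀ S : Set V, S.ncard < k → (G.induce Sᶜ).Connected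

namespace SimpleGraph

variable {V : Type*} {F : SimpleGraph V}

/-- In a forest, a vertex has at most one neighbour that is no further from a root `s`. -/
theorem IsAcyclic.eq_of_adj_of_dist_le (hF : F.IsAcyclic) {s b u v : V} (hb : F.Reachable s b)
    (hu : F.Adj b u) (hv : F.Adj b v) (hub : F.dist s u ≤ F.dist s b)
    (hvb : F.dist s v ≤ F.dist s b) : u = v := by
  classical
  have key : ∀ w, F.Adj b w → F.dist s w ≤ F.dist s b →
      ∃ p : F.Walk s b, p.IsPath ∧ p.penultimate = w := by
    intro w hw hd
    obtain ⟨p, hp, hl⟩ := (hb.trans hw.reachable).exists_path_of_dist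
    have hbp : b ∉ p.support := by
      intro hmem
      have hlt := p.length_takeUntil_lt_length hmem hw.ne
      have := F.dist_le (p.takeUntil b hmem)
      omega
    exact ⟨p.concat hw.symm, hp.concat hbp hw.symm, by simp⟩
  obtain ⟨p, hp, rfl⟩ := key u hu hub
  obtain ⟨q, hq, rfl⟩ := key v hv hvb
  have := (hF.subsingleton_path s b).elim ⟨p, hp⟩ ⟨q, hq⟩
  rw [Subtype.mk.injEq] at this
  rw [this]

/-- If every vertex of a finite nonempty set `X` lies in the same component of a forest as `s`,
then some vertex of `X` has at most one neighbour in `insert s X`. -/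
theorem IsAcyclic.exists_subsingleton_neighborSet_inter (hF : F.IsAcyclic) (s : V) {X : Set V}
    (hfin : X.Finite) (hne : X.Nonempty) (hX : ∀ b ∈ X, F.Reachable s b) :
    ∃ b ∈ X, (F.neighborSet b ∩ insert s X).Subsingleton := by
  obtain ⟨b, hb, hmax⟩ := Set.exists_max_image X (F.dist s) hfin hne
  have hle : ∀ w ∈ insert s X, F.dist s w ≤ F.dist s b := by
    rintro w (rfl | hw)
    · simp
    · exact hmax w hw
  exact ⟨b, hb, fun u hu v hv =>
    hF.eq_of_adj_of_dist_le (hX b hb) hu.1 hv.1 (hle u hu.2) (hle v hv.2)⟩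

end SimpleGraph

/-- A set with at most two elements is contained in a pair with any prescribed member. -/
theorem Set.exists_subset_pair_of_ncard_lt_three {α : Type*} {S : Set α} (hfin : S.Finite)
    (hS : S.ncard < 3) {a : α} (ha : a ∈ S) : ∃ b, ∀ x ∈ S, x = a ∨ x = b := by
  have hle : (S \ {a}).ncard ≤ 1 := by
    rw [Set.ncard_sdiff_singleton_of_mem ha]
    omega
  rcases (S \ {a}).eq_empty_or_nonempty with h | ⟨b, hb⟩
  · exact ⟨a, fun x hx => by
      by_contra hxa
      have : x ∈ S \ {a} := ⟨hx, by simpa using hxa⟩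
      simp [h] at this⟩
  · refine ⟨b, fun x hx => ?_⟩
    by_cases hxa : x = a
    · exact Or.inl hxa
    · exact Or.inr ((Set.ncard_le_one hfin.sdiff).1 hle x ⟨hx, hxa⟩ b hb)

/-- Suppose the fibres of `f` are the components of `F ≤ G` and adjacency in `G'` lifts to `G`.
A vertex set that is closed under adjacency in `G` outside `S` and contains a vertex `v₀` whose
fibre avoids `S` contains every vertex whose fibre is joined to that of `v₀` off the image of `S`. -/
theorem SimpleGraph.mem_of_reachable_induce_compl_image {V W : Type*} {G F : SimpleGraph V}
    (hFG : F ≤ G) {f : V → W} (hfib : ∀ v w : V, f v = f w ↔ F.Reachable v w)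
    {G' : SimpleGraph W}
    (hadj : ∀ a b : W, G'.Adj a b → ∃ v w : V, f v = a ∧ f w = b ∧ G.Adj v w)
    {S P : Set V} (hP : ∀ v w, v ∈ P → G.Adj v w → w ∉ S → w ∈ P) {v₀ : V} (hv₀ : v₀ ∈ P)
    {a b : ((f '' S)ᶜ : Set W)} (ha : a = f v₀) (hab : (G'.induce (f '' S)ᶜ).Reachable a b)
    {v : V} (hv : f v = b) : v ∈ P := by
  have fibre : ∀ v w, F.Reachable v w → f v ∉ f '' S → v ∈ P → w ∈ P := by
    rintro v w ⟨p⟩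
    induction p with
    | nil => exact fun _ h => h
    | @cons x y z h _ ih =>
      intro hx hxP
      have hxy : f x = f y := (hfib x y).2 h.reachable
      rw [hxy] at hx
      exact ih hx (hP x y hxP (hFG h) fun hy => hx ⟨y, hy, rfl⟩)
  obtain ⟨p⟩ := hab
  induction p generalizing v₀ with
  | @nil x => exact fibre v₀ v ((hfib _ _).1 (ha.symm.trans hv.symm)) (ha ▸ x.2) hv₀
  | @cons x y z h _ ih =>
    obtain ⟨u, w, hu, hw, huw⟩ := hadj x y h
    have huP : u ∈ P :=
      fibre v₀ u ((hfib _ _).1 (ha.symm.trans hu.symm)) (ha ▸ x.2) hv₀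
    have hwS : w ∉ S := fun hwS => y.2 ⟨w, hwS, hw⟩
    exact ih (hP u w huP huw hwS) hw.symm hv

/-- Let `G` have minimum degree at least three and let `F ≤ G` be a forest in `G`.
The contraction `G/E(F)` is encoded by a surjection `f : V → W` whose fibres are exactly the
components of `F`, together with the graph `G'` on `W` whose adjacency is induced by `G`-edges;
the hypotheses `hnoloops` and `hnomulti` say that the contraction is simple (it creates no
loops and no multiple edges).  If `G/E(F)` is simple and 3-connected, then `G` is
3-connected. -/
theorem three_connected_of_contract_forest {V W : Type*} [Fintype V] [Fintype W]
    (G F : SimpleGraph V) (hFG : F ≤ G) (hforest : F.IsAcyclic)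
    (hdeg : ∀ v : V, 3 ≤ (G.neighborSet v).ncard)
    (f : V → W) (hsurj : Function.Surjective f)
    (hfib : ∀ v w : V, f v = f w ↔ F.Reachable v w)
    (G' : SimpleGraph W)
    (hadj : ∀ a b : W, G'.Adj a b ↔ a ≠ b ∧ ∃ v w : V, f v = a ∧ f w = b ∧ G.Adj v w)
    (hnoloops : ∀ v w : V, G.Adj v w → f v = f w → F.Adj v w)
    (hnomulti : ∀ v₁ w₁ v₂ w₂ : V, G.Adj v₁ w₁ → ¬ F.Adj v₁ w₁ → G.Adj v₂ w₂ → ¬ F.Adj v₂ w₂ →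
      f v₁ = f v₂ → f w₁ = f w₂ → s(v₁, w₁) = s(v₂, w₂))
    (h3 : KConnected 3 G') : KConnected 3 G := by
  classical
  obtain ⟨hcard, hconn⟩ := h3
  refine ⟨hcard.trans_le (Nat.card_le_card_of_surjective f hsurj), fun S hS => ?_⟩
  have hG' := hconn (f '' S) ((Set.ncard_image_le S.toFinite).trans_lt hS)
  obtain ⟨⟨a, ha⟩⟩ := hG'.nonempty
  obtain ⟨v₀, rfl⟩ := hsurj a
  have hv₀ : v₀ ∈ Sᶜ := fun h => ha ⟨v₀, h, rfl⟩
  let P : Set V := {v | ∃ hv : v ∈ Sᶜ, (G.induce Sᶜ).Reachable ⟨v₀, hv₀⟩ ⟨v, hv⟩}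
  have hP : ∀ v w, v ∈ P → G.Adj v w → w ∉ S → w ∈ P := by
    rintro v w ⟨hv, hr⟩ hvw hw
    have hvw' : (G.induce Sᶜ).Adj ⟨v, hv⟩ ⟨w, hw⟩ := hvw
    exact ⟨hw, hr.trans hvw'.reachable⟩
  have hPfib : ∀ v, f v ∉ f '' S → v ∈ P := fun v hv =>
    mem_of_reachable_induce_compl_image hFG hfib (fun a b h => ((hadj a b).1 h).2) hP
      ⟨hv₀, Reachable.refl _⟩ rfl (hG'.preconnected ⟨f v₀, ha⟩ ⟨f v, hv⟩) rfl
  suffices hall : ∀ v, v ∉ S → v ∈ P from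
    connected_iff_exists_forall_reachable _ |>.2 ⟨⟨v₀, hv₀⟩, fun ⟨v, hv⟩ => (hall v hv).2⟩
  by_contra! hB
  obtain ⟨b₀, hb₀S, hb₀P⟩ := hB
  obtain ⟨s₁, hs₁, hfs₁⟩ : f b₀ ∈ f '' S := by
    by_contra h
    exact hb₀P (hPfib b₀ h)
  obtain ⟨s₂, hS₂⟩ := Set.exists_subset_pair_of_ncard_lt_three S.toFinite hS hs₁
  let X : Set V := {v | v ∉ S ∧ v ∉ P ∧ f v = f s₁}
  obtain ⟨b, ⟨hbS, hbP, hfb⟩, hsub⟩ := hforest.exists_subsingleton_neighborSet_inter s₁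
    X.toFinite ⟨b₀, hb₀S, hb₀P, hfs₁.symm⟩ fun b hb => (hfib _ _).1 hb.2.2.symm
  have hnear : (G.neighborSet b ∩ insert s₁ X).Subsingleton := by
    refine hsub.anti fun w hw => ⟨hnoloops b w hw.1 ?_, hw.2⟩
    rcases hw.2 with rfl | hwX
    · exact hfb
    · exact hfb.trans hwX.2.2.symm
  have hfar : ∀ w ∈ G.neighborSet b \ insert s₁ X, w = s₂ ∨ f w = f s₂ ∧ f w ≠ f s₁ := by
    rintro w ⟨hw, hwX⟩
    rw [Set.mem_insert_iff, not_or] at hwX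
    by_cases hwS : w ∈ S
    · exact Or.inl ((hS₂ w hwS).resolve_left hwX.1)
    · have hwP : w ∉ P := fun h => hbP (hP w b h hw.symm hbS)
      have hne : f w ≠ f s₁ := fun h => hwX.2 ⟨hwS, hwP, h⟩
      obtain ⟨s, hs, hfs⟩ : f w ∈ f '' S := by
        by_contra h
        exact hwP (hPfib w h)
      rcases hS₂ s hs with rfl | rfl
      · exact absurd hfs.symm hne
      · exact Or.inr ⟨hfs.symm, hne⟩
  have hfar' : (G.neighborSet b \ insert s₁ X).Subsingleton := by
    intro u hu v hv
    have hnF : ∀ w, f w ≠ f s₁ → ¬ F.Adj b w := fun w hw h =>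
      hw (((hfib b w).2 h.reachable).symm.trans hfb)
    by_cases hs : f s₂ = f s₁
    · have h : ∀ w ∈ G.neighborSet b \ insert s₁ X, w = s₂ := fun w hw =>
        (hfar w hw).resolve_right fun h => h.2 (h.1.trans hs)
      rw [h u hu, h v hv]
    · have h : ∀ w ∈ G.neighborSet b \ insert s₁ X, f w = f s₂ := fun w hw =>
        (hfar w hw).elim (congrArg f) And.left
      have huv := hnomulti b u b v hu.1 (hnF u (h u hu ▸ hs)) hv.1 (hnF v (h v hv ▸ hs)) rfl
        ((h u hu).trans (h v hv).symm)
      exact Sym2.congr_right.1 huv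
  have h₁ := Set.ncard_le_one_iff_subsingleton.2 hnear
  have h₂ := Set.ncard_le_one_iff_subsingleton.2 hfar'
  have h₃ := Set.ncard_inter_add_ncard_sdiff_eq_ncard (G.neighborSet b) (insert s₁ X)
  have := hdeg b
  omega
end

section
/- Let G be a graph that is both minimally 3-connected and critically 3-connected, and let F be the subgraph of G induced by the vertices of degree greater than three. Then the contraction G/E(F) is simple, and it is both minimally 3-connected and critically 3-connected. -/
open SimpleGraph

/-- A graph is minimally `k`-connected if it is `k`-connected but the deletion of any edge
destroys `k`-connectedness. -/
def MinimallyKConnected {V : Type*} (k : ℕ) (G : SimpleGraph V) : Prop :=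
  KConnected k G ∧ ∀ e ∈ G.edgeSet, ¬ KConnected k (G.deleteEdges {e})

/-- A graph is critically `k`-connected if it is `k`-connected but the deletion of any vertex
destroys `k`-connectedness. -/
def CriticallyKConnected {V : Type*} (k : ℕ) (G : SimpleGraph V) : Prop :=
  KConnected k G ∧ ∀ v : V, ¬ KConnected k (G.induce {v}ᶜ)

/-- `A`, `S`, `B` partition the vertices, `A` and `B` are nonempty, and no edge joins `A` to `B`. -/
def IsSeparation {V : Type*} (G : SimpleGraph V) (S A B : Set V) : Prop :=
  A.Nonempty ∧ B.Nonempty ∧ (∀ x, x ∈ A ∨ x ∈ B ∨ x ∈ S) ∧ (∀ x ∈ A, x ∉ B ∧ x ∉ S) ∧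
    (∀ x ∈ B, x ∉ S) ∧ ∀ x ∈ A, ∀ y ∈ B, ¬ G.Adj x y

theorem IsSeparation.symm {V : Type*} {G : SimpleGraph V} {S A B : Set V}
    (h : IsSeparation G S A B) : IsSeparation G S B A := by
  obtain ⟨hA, hB, hc, hd, he, hn⟩ := h
  refine ⟨hB, hA, fun x => ?_, fun x hx => ⟨fun hx' => (hd x hx').1 hx, he x hx⟩,
    fun x hx => (hd x hx).2, fun x hx y hy h => hn y hy x hx h.symm⟩
  have := hc x
  tauto

theorem kConnected_iff_isSeparation {V : Type*} {k : ℕ} {G : SimpleGraph V} :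
    KConnected k G ↔ k < Nat.card V ∧ ∀ S A B, IsSeparation G S A B → k ≤ S.ncard := by
  refine and_congr_right fun hk => ⟨fun h S A B hs => ?_, fun h S hS => ?_⟩
  · by_contra! hlt
    obtain ⟨⟨a, ha⟩, ⟨b, hb⟩, hc, hd, he, hn⟩ := hs
    obtain ⟨p⟩ := (h S hlt).preconnected ⟨a, (hd a ha).2⟩ ⟨b, he b hb⟩
    have key : ∀ x y : (Sᶜ : Set V), (G.induce Sᶜ).Walk x y → (x : V) ∈ A → (y : V) ∈ A := by
      intro x y w
      induction w with
      | nil => exact id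
      | @cons x y z hxy w ih =>
        intro hx
        apply ih
        rcases hc y with h1 | h1 | h1
        · exact h1
        · exact absurd hxy (hn _ hx _ h1)
        · exact absurd h1 y.2
    exact (hd b (key _ _ p ha)).1 hb
  · have hfin : Finite V := Nat.finite_of_card_ne_zero (by omega)
    have hne : (Sᶜ : Set V).Nonempty := by
      rw [Set.nonempty_compl]
      rintro rfl
      rw [Set.ncard_univ] at hS
      omega
    have : Nonempty (Sᶜ : Set V) := hne.to_subtype
    refine ⟨fun a b => ?_⟩
    by_contra hab
    have := h S {x | ∃ hx : x ∉ S, (G.induce Sᶜ).Reachable a ⟨x, hx⟩}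
      {x | ∃ hx : x ∉ S, ¬ (G.induce Sᶜ).Reachable a ⟨x, hx⟩}
      ⟨⟨a, a.2, Reachable.refl _⟩, ⟨b, b.2, hab⟩, fun x => ?_, ?_, ?_, ?_⟩
    · omega
    · simp only [Set.mem_ofPred_eq]
      by_cases hx : x ∈ S
      · exact Or.inr (Or.inr hx)
      · by_cases hr : (G.induce Sᶜ).Reachable a ⟨x, hx⟩
        · exact Or.inl ⟨hx, hr⟩
        · exact Or.inr (Or.inl ⟨hx, hr⟩)
    · rintro x ⟨hx, hr⟩
      exact ⟨fun ⟨_, hr'⟩ => hr' hr, hx⟩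
    · rintro x ⟨hx, hr⟩
      exact hx
    · rintro x ⟨hx, hr⟩ y ⟨hy, hr'⟩ hxy
      exact hr' (hr.trans (Adj.reachable (G := G.induce Sᶜ) (u := ⟨x, hx⟩) (v := ⟨y, hy⟩) hxy))

theorem kConnected_induce_compl_singleton_iff {V : Type*} [Finite V] {k : ℕ} {G : SimpleGraph V}
    {z : V} : KConnected k (G.induce {z}ᶜ) ↔
      k + 1 < Nat.card V ∧ ∀ S A B, IsSeparation G S A B → z ∈ S → k + 1 ≤ S.ncard := by
  have hcard : Nat.card ({z}ᶜ : Set V) + 1 = Nat.card V := by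
    rw [Nat.card_coe_set_eq, ← Set.ncard_singleton z, add_comm, Set.ncard_add_ncard_compl]
  rw [kConnected_iff_isSeparation]
  refine and_congr (by omega) ⟨fun h S A B hs hz => ?_, fun h S A B hs => ?_⟩
  · obtain ⟨⟨a, ha⟩, ⟨b, hb⟩, hc, hd, he, hn⟩ := hs
    have := h (Subtype.val ⁻¹' S) (Subtype.val ⁻¹' A) (Subtype.val ⁻¹' B)
      ⟨⟨⟨a, fun h => (hd a ha).2 (h ▸ hz)⟩, ha⟩, ⟨⟨b, fun h => he b hb (h ▸ hz)⟩, hb⟩,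
        fun x => hc x, fun x hx => hd x hx, fun x hx => he x hx,
        fun x hx y hy hxy => hn x hx y hy hxy⟩
    have h2 : (Subtype.val ⁻¹' S : Set ({z}ᶜ : Set V)).ncard = (S \ {z}).ncard := by
      rw [← Set.ncard_image_of_injective _ Subtype.val_injective]
      congr 1
      ext x
      simp [and_comm]
    have h3 := Set.ncard_sdiff_singleton_add_one hz
    omega
  · obtain ⟨⟨a, ha⟩, ⟨b, hb⟩, hc, hd, he, hn⟩ := hs
    have := h (insert z (Subtype.val '' S)) (Subtype.val '' A) (Subtype.val '' B)
      ⟨⟨a, a, ha, rfl⟩, ⟨b, b, hb, rfl⟩, fun x => ?_, ?_, ?_, ?_⟩ (Set.mem_insert _ _)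
    · rw [Set.ncard_insert_of_notMem (by simp),
        Set.ncard_image_of_injective _ Subtype.val_injective] at this
      omega
    · by_cases hx : x = z
      · simp [hx]
      · rcases hc ⟨x, hx⟩ with h | h | h
        · exact Or.inl ⟨_, h, rfl⟩
        · exact Or.inr (Or.inl ⟨_, h, rfl⟩)
        · exact Or.inr (Or.inr (Or.inr ⟨_, h, rfl⟩))
    · rintro _ ⟨x, hx, rfl⟩
      have hxz : (x : V) ≠ z := x.2
      have := hd x hx
      simpa [hxz] using this
    · rintro _ ⟨x, hx, rfl⟩
      have hxz : (x : V) ≠ z := x.2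
      have := he x hx
      simpa [hxz] using this
    · rintro _ ⟨x, hx, rfl⟩ _ ⟨y, hy, rfl⟩ hxy
      exact hn x hx y hy hxy

theorem Set.exists_eq_pair_of_ncard_lt_three {V : Type*} [Finite V] {S : Set V}
    (hS : S.ncard < 3) {a : V} (ha : a ∈ S) : ∃ b, S = {a, b} := by
  have h := Set.ncard_sdiff_singleton_add_one ha
  have h1 : (S \ {a}).ncard ≤ 1 := by omega
  rcases (S \ {a}).eq_empty_or_nonempty with he | ⟨b, hb⟩
  · refine ⟨a, ?_⟩
    ext x
    have : x ∉ S \ {a} := by simp [he]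
    grind
  · refine ⟨b, ?_⟩
    rw [Set.ncard_le_one] at h1
    ext x
    have := h1 x
    grind

/-- In a 3-connected graph, a vertex set attached only to two vertices leaves nothing else out. -/
theorem KConnected.eq_or_eq_of_neighbors_subset {V : Type*} {G : SimpleGraph V}
    (hG : KConnected 3 G) {X : Set V} {p q r : V}
    (hX : ∀ x ∈ X, ∀ y, G.Adj x y → y ∈ X ∨ y = p ∨ y = q) (hr : r ∉ X) (hrp : r ≠ p)
    (hrq : r ≠ q) : ∀ x ∈ X, x = p ∨ x = q := by
  by_contra! h
  obtain ⟨x, hx, hxp, hxq⟩ := h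
  have := (kConnected_iff_isSeparation.1 hG).2 {p, q} (X \ {p, q}) {y | y ∉ X ∧ y ≠ p ∧ y ≠ q}
    ⟨⟨x, hx, by simp [hxp, hxq]⟩, ⟨r, hr, hrp, hrq⟩, by grind, by grind, by grind, ?_⟩
  · have := Set.ncard_insert_le p {q}
    rw [Set.ncard_singleton] at this
    omega
  · rintro a ⟨ha, -⟩ b hb hab
    have := hX a ha b hab
    grind

/-- If deleting the edge `uv` destroys 3-connectedness, then fewer than three vertices separate `u`
from `v` in the remaining graph. -/
theorem KConnected.exists_isSeparation_deleteEdges {V : Type*} {G : SimpleGraph V}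
    (hG : KConnected 3 G) {u v : V} (huv : ¬ KConnected 3 (G.deleteEdges {s(u, v)})) :
    ∃ S A B, IsSeparation (G.deleteEdges {s(u, v)}) S A B ∧ u ∈ A ∧ v ∈ B ∧ S.ncard < 3 := by
  rw [kConnected_iff_isSeparation] at hG huv
  push Not at huv
  obtain ⟨S, A, B, hs, hS⟩ := huv hG.1
  by_cases h1 : u ∈ A ∧ v ∈ B
  · exact ⟨S, A, B, hs, h1.1, h1.2, hS⟩
  by_cases h2 : v ∈ A ∧ u ∈ B
  · exact ⟨S, B, A, hs.symm, h2.2, h2.1, hS⟩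
  exfalso
  have := hG.2 S A B ⟨hs.1, hs.2.1, hs.2.2.1, hs.2.2.2.1, hs.2.2.2.2.1, fun a ha b hb hab => ?_⟩
  · omega
  · apply hs.2.2.2.2.2 a ha b hb
    rw [deleteEdges_adj]
    refine ⟨hab, fun h => ?_⟩
    rw [Set.mem_singleton_iff, Sym2.eq_iff] at h
    grind

theorem exists_mem_ne_of_three_lt_degree {V : Type*} [Finite V] {G : SimpleGraph V} {u v : V}
    {S A B : Set V} (hs : IsSeparation (G.deleteEdges {s(u, v)}) S A B) (hu : u ∈ A)
    (hS : S.ncard < 3) (hdeg : 3 < (G.neighborSet u).ncard) :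
    ∃ a ∈ A, a ≠ u := by
  by_contra! h
  have hsub : G.neighborSet u ⊆ insert v S := by
    intro y hy
    rcases hs.2.2.1 y with h1 | h1 | h1
    · exact absurd (h y h1) (G.ne_of_adj hy).symm
    · have := hs.2.2.2.2.2 u hu y h1
      rw [deleteEdges_adj, Set.mem_singleton_iff, Sym2.eq_iff] at this
      have hy' : G.Adj u y := hy
      grind
    · exact Or.inr h1
  have := Set.ncard_le_ncard hsub
  have := Set.ncard_insert_le v S
  omega

theorem IsSeparation.eq_of_adj {V : Type*} {G : SimpleGraph V} {u v : V}
    {S A B : Set V} (hs : IsSeparation (G.deleteEdges {s(u, v)}) S A B) (hu : u ∈ A)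
    {a b : V} (ha : a ∈ A) (hb : b ∈ B) (hab : G.Adj a b) : a = u ∧ b = v := by
  have := hs.2.2.2.2.2 a ha b hb
  have := (hs.2.2.2.1 u hu).1
  rw [deleteEdges_adj, Set.mem_singleton_iff, Sym2.eq_iff] at *
  grind

theorem MinimallyKConnected.not_triangle {V : Type*} [Finite V] {G : SimpleGraph V}
    (hG : MinimallyKConnected 3 G) {u v w : V} (hu : 3 < (G.neighborSet u).ncard)
    (hv : 3 < (G.neighborSet v).ncard) (huv : G.Adj u v) (huw : G.Adj u w) : ¬ G.Adj v w := by
  intro hvw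
  obtain ⟨S, A, B, hs, huA, hvB, hS⟩ := hG.1.exists_isSeparation_deleteEdges (hG.2 s(u, v) huv)
  obtain ⟨T, C, D, ht, huC, hwD, hT⟩ := hG.1.exists_isSeparation_deleteEdges (hG.2 s(u, w) huw)
  obtain ⟨a, haA, hau⟩ := exists_mem_ne_of_three_lt_degree hs huA hS hu
  obtain ⟨c, hcC, hcu⟩ := exists_mem_ne_of_three_lt_degree ht huC hT hu
  obtain ⟨b, hbB, hbv⟩ := exists_mem_ne_of_three_lt_degree (by rw [Sym2.eq_swap]; exact hs.symm)
    hvB hS hv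
  have hsn : ∀ a ∈ A, ∀ b ∈ B, G.Adj a b → a = u ∧ b = v := fun _ ha _ hb h =>
    hs.eq_of_adj huA ha hb h
  have htn : ∀ a ∈ C, ∀ b ∈ D, G.Adj a b → a = u ∧ b = w := fun _ ha _ hb h =>
    ht.eq_of_adj huC ha hb h
  have huv' := huv.ne
  have huw' := huw.ne
  have hvw' := hvw.ne
  obtain ⟨-, -, hs1, hs2, hs3, -⟩ := hs
  obtain ⟨-, -, ht1, ht2, ht3, -⟩ := ht
  have hwS : w ∈ S := by
    have h1 := hsn u huA w
    have h2 := fun h => hsn w h v hvB hvw.symm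
    grind
  have hvT : v ∈ T := by
    have h1 := htn u huC v
    have h2 := fun h => htn v h w hwD hvw
    grind
  obtain ⟨y, rfl⟩ := Set.exists_eq_pair_of_ncard_lt_three hS hwS
  obtain ⟨z, rfl⟩ := Set.exists_eq_pair_of_ncard_lt_three hT hvT
  have hAB : ∀ x ∈ A, ∀ n, G.Adj x n → x ≠ u → n ∈ A ∨ n = w ∨ n = y := by grind
  have hBA : ∀ x ∈ B, ∀ n, G.Adj x n → x ≠ v → n ∈ B ∨ n = w ∨ n = y := by
    intro x hx n hn
    have := fun h => hsn n h x hx hn.symm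
    grind
  have hCD : ∀ x ∈ C, ∀ n, G.Adj x n → x ≠ u → n ∈ C ∨ n = v ∨ n = z := by grind
  have hDC : ∀ x ∈ D, ∀ n, G.Adj x n → x ≠ w → n ∈ D ∨ n = v ∨ n = z := by
    intro x hx n hn
    have := fun h => htn n h x hx hn.symm
    grind
  simp only [Set.mem_insert_iff, Set.mem_singleton_iff] at hs1 hs2 hs3 ht1 ht2 ht3
  clear hwS hvT hsn htn hS hT hvw huw huv hu hv
  have hAC : (y ∈ D ∨ z ∈ B ∨ y = z) → ∀ x ∈ A, x ∈ C → x = u := by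
    intro h x hxA hxC
    by_contra hxu
    obtain ⟨q, hq, hqA⟩ : ∃ q, (∀ n, (n ∈ A ∨ n = w ∨ n = y) → (n ∈ C ∨ n = v ∨ n = z) →
        (n ∈ A ∧ n ∈ C) ∨ n = q) ∧ q ≠ w ∧ (q ∉ A ∨ q ∉ C) := by
      by_cases hy : y ∈ C
      · exact ⟨y, by grind⟩
      · exact ⟨z, by grind⟩
    have := hG.1.eq_or_eq_of_neighbors_subset (X := {x | x ∈ A ∧ x ∈ C ∧ x ≠ u}) (p := u)
      (q := q) (r := w) (by
        rintro x ⟨h1, h2, h3⟩ n hn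
        have := hq n (hAB x h1 n hn h3) (hCD x h2 n hn h3)
        grind) (by grind) (by grind) (by grind) x ⟨hxA, hxC, hxu⟩
    grind
  have hAD : y ∉ D → ∀ x ∈ A, x ∉ D := by
    intro h x hxA hxD
    have := hG.1.eq_or_eq_of_neighbors_subset (X := {x | x ∈ A ∧ x ∈ D}) (p := w)
      (q := z) (r := u) (by
        rintro x ⟨h1, h2⟩ n hn
        have := hAB x h1 n hn
        have := hDC x h2 n hn
        grind) (by grind) (by grind) (by grind) x
        ⟨by assumption, by assumption⟩
    grind
  have hBC : z ∉ B ∨ y ∈ D → ∀ x ∈ B, x ∉ C := by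
    intro h x hxB hxC
    obtain ⟨q, hq, hqu⟩ : ∃ q, (∀ n, (n ∈ B ∨ n = w ∨ n = y) → (n ∈ C ∨ n = v ∨ n = z) →
        (n ∈ B ∧ n ∈ C) ∨ n = v ∨ n = q) ∧ q ≠ u ∧ (q ∉ B ∨ q ∉ C) := by
      by_cases hy : y ∈ D
      · exact ⟨z, by grind⟩
      · exact ⟨y, by grind⟩
    have := hG.1.eq_or_eq_of_neighbors_subset (X := {x | x ∈ B ∧ x ∈ C}) (p := v)
      (q := q) (r := u) (by
        rintro x ⟨h1, h2⟩ n hn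
        have := hBA x h1 n hn
        have := hCD x h2 n hn
        grind) (by grind) (by grind) (by grind) x
        ⟨by assumption, by assumption⟩
    grind
  have hBD : y ∈ C → z ∈ A → ∀ x ∈ B, x ∉ D := by
    intro h h' x hxB hxD
    have := hG.1.eq_or_eq_of_neighbors_subset (X := {x | x ∈ B ∧ x ∈ D}) (p := v)
      (q := w) (r := u) (by
        rintro x ⟨h1, h2⟩ n hn
        have := hBA x h1 n hn
        have := hDC x h2 n hn
        grind) (by grind) (by grind) (by grind) x
        ⟨by assumption, by assumption⟩
    grind
  by_cases hyz : y = z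
  · grind
  by_cases hyD : y ∈ D
  · grind
  have hyC : y ∈ C := by grind
  by_cases hzB : z ∈ B
  · grind
  have hzA : z ∈ A := by grind
  have h1 := hBC (Or.inl hzB) b hbB
  have h2 := hBD hyC hzA b hbB
  rcases ht1 b with h | h | h | rfl
  · exact h1 h
  · exact h2 h
  · exact hbv h
  · exact hzB hbB

theorem KConnected.false_of_crossing {V : Type*} [Finite V] {G : SimpleGraph V}
    (hG : KConnected 3 G) {u v w b : V} {S A B C D : Set V}
    (hs : IsSeparation (G.deleteEdges {s(u, v)}) S A B) (hu : u ∈ A) (hv : v ∈ B)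
    (hS : S.ncard < 3) (ht : IsSeparation G {u, v, w} C D) (hw : w ∉ B) (hb : b ∈ B)
    (hbv : b ≠ v) (hbC : b ∈ C) : False := by
  have hsn : ∀ x ∈ A, ∀ n, G.Adj x n → x ≠ u → n ∈ A ∨ n ∈ S := by
    intro x hx n hn hxu
    have := fun h => hs.eq_of_adj hu hx (b := n) h hn
    have := hs.2.2.1 n
    grind
  have hsn' : ∀ x ∈ B, ∀ n, G.Adj x n → x ≠ v → n ∈ B ∨ n ∈ S := by
    intro x hx n hn hxu
    have := fun h => hs.eq_of_adj hu (a := n) h hx hn.symm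
    have := hs.2.2.1 n
    grind
  have htn : ∀ x ∈ C, ∀ n, G.Adj x n → n ∈ C ∨ n = u ∨ n = v ∨ n = w := by
    intro x hx n hn
    have := fun h => ht.2.2.2.2.2 x hx n h hn
    have := ht.2.2.1 n
    grind
  have htn' : ∀ x ∈ D, ∀ n, G.Adj x n → n ∈ D ∨ n = u ∨ n = v ∨ n = w := by
    intro x hx n hn
    have := fun h => ht.2.2.2.2.2 n h x hx hn.symm
    have := ht.2.2.1 n
    grind
  obtain ⟨-, -, hs1, hs2, hs3, -⟩ := hs
  obtain ⟨-, ⟨d, hd⟩, ht1, ht2, ht3, -⟩ := ht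
  simp only [Set.mem_insert_iff, Set.mem_singleton_iff] at ht1 ht2 ht3
  have hSD : ∀ x ∈ S, x ∉ D := by
    intro x hxS hxD
    obtain ⟨y, rfl⟩ := Set.exists_eq_pair_of_ncard_lt_three hS hxS
    clear hS
    simp only [Set.mem_insert_iff, Set.mem_singleton_iff] at hs1 hs2 hs3 hsn hsn'
    have := hG.eq_or_eq_of_neighbors_subset (X := {x | x ∈ B ∧ x ∈ C}) (p := v)
      (q := y) (r := u) (by
        rintro x ⟨h1, h2⟩ n hn
        have := hsn' x h1 n hn
        have := htn x h2 n hn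
        grind) (by grind) (by grind) (by grind) b ⟨hb, hbC⟩
    grind
  have hBD : ∀ x ∈ B, x ∉ D := by
    intro x hxB hxD
    have := hG.eq_or_eq_of_neighbors_subset (X := {x | x ∈ B ∧ x ∈ D}) (p := v)
      (q := w) (r := b) (by
        rintro x ⟨h1, h2⟩ n hn
        have := hsn' x h1 n hn
        have := htn' x h2 n hn
        grind) (by grind) (by grind) (by grind) x ⟨hxB, hxD⟩
    grind
  have := hG.eq_or_eq_of_neighbors_subset (X := D) (p := u) (q := w) (r := b) (by
    intro x h1 n hn
    have := hsn x (by grind) n hn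
    have := htn' x h1 n hn
    grind) (by grind) (by grind) (by grind) d hd
  grind

/-- The ends of an essential edge, both of degree at least four, lie in no common 3-separator. -/
theorem KConnected.not_isSeparation_insert {V : Type*} [Finite V] {G : SimpleGraph V}
    (hG : KConnected 3 G) {u v : V} (huv : ¬ KConnected 3 (G.deleteEdges {s(u, v)}))
    (hu : 3 < (G.neighborSet u).ncard) (hv : 3 < (G.neighborSet v).ncard) (w : V) (C D : Set V) :
    ¬ IsSeparation G {u, v, w} C D := by
  intro ht
  obtain ⟨S, A, B, hs, huA, hvB, hS⟩ := hG.exists_isSeparation_deleteEdges huv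
  have hs' : IsSeparation (G.deleteEdges {s(v, u)}) S B A := by
    rw [Sym2.eq_swap]
    exact hs.symm
  have ht' : ∀ {C D}, IsSeparation G {u, v, w} C D → IsSeparation G {v, u, w} C D := by
    intro C D h
    rwa [Set.insert_comm]
  obtain ⟨a, haA, hau⟩ := exists_mem_ne_of_three_lt_degree hs huA hS hu
  obtain ⟨b, hbB, hbv⟩ := exists_mem_ne_of_three_lt_degree hs' hvB hS hv
  have hAB := hs.2.2.2.1
  by_cases hw : w ∈ B
  · rcases ht.2.2.1 a with h | h | h
    · exact hG.false_of_crossing hs' hvB huA hS (ht' ht) (fun h => (hAB w h).1 hw) haA hau h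
    · exact hG.false_of_crossing hs' hvB huA hS (ht' ht.symm) (fun h => (hAB w h).1 hw) haA hau h
    · grind
  · rcases ht.2.2.1 b with h | h | h
    · exact hG.false_of_crossing hs huA hvB hS ht hw hbB hbv h
    · exact hG.false_of_crossing hs huA hvB hS ht.symm hw hbB hbv h
    · grind

/-- The simple graph obtained from `G` by identifying vertices along `π`. -/
def identifyAlong {V W : Type*} (π : V → W) (G : SimpleGraph V) : SimpleGraph W where
  Adj a b := a ≠ b ∧ ∃ x y, π x = a ∧ π y = b ∧ G.Adj x y
  symm := ⟨fun _ _ ⟨h, x, y, hx, hy, hxy⟩ => ⟨h.symm, y, x, hy, hx, hxy.symm⟩⟩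
  loopless := ⟨fun _ h => h.1 rfl⟩

theorem identifyAlong_adj {V W : Type*} {π : V → W} {G : SimpleGraph V} {a b : W} :
    (identifyAlong π G).Adj a b ↔ a ≠ b ∧ ∃ x y, π x = a ∧ π y = b ∧ G.Adj x y := Iff.rfl

theorem IsSeparation.preimage {V W : Type*} {G : SimpleGraph V} {π : V → W}
    (hπ : Function.Surjective π) {S A B : Set W} (hs : IsSeparation (identifyAlong π G) S A B) :
    IsSeparation G (π ⁻¹' S) (π ⁻¹' A) (π ⁻¹' B) := by
  obtain ⟨hA, hB, hc, hd, he, hn⟩ := hs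
  exact ⟨hA.preimage hπ, hB.preimage hπ, fun x => hc _, fun x hx => hd _ hx, fun x hx => he _ hx,
    fun x hx y hy hxy => hn _ hx _ hy
      ⟨fun h => (hd _ hx).1 (h ▸ hy), x, y, rfl, rfl, hxy⟩⟩

/-- `π` identifies the two vertices `u` and `v` and nothing else. -/
def IdentifiesOnly {V W : Type*} (π : V → W) (u v : V) : Prop :=
  Function.Surjective π ∧ ∀ x y, π x = π y ↔ x = y ∨ (x = u ∧ y = v) ∨ (x = v ∧ y = u)

theorem IsSeparation.exists_notMem_image {V W : Type*} [Finite V] {G : SimpleGraph V} {π : V → W}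
    {u v : V} (hπ : IdentifiesOnly π u v) {S A B : Set V} (hs : IsSeparation G S A B)
    (hu : S.ncard < (G.neighborSet u).ncard) (hv : S.ncard < (G.neighborSet v).ncard) :
    (π '' A \ π '' S).Nonempty := by
  by_contra hne
  have hsub : ∀ a ∈ A, ∃ s ∈ S, (s = u ∧ a = v) ∨ (s = v ∧ a = u) := by
    intro a ha
    by_contra! h
    refine hne ⟨π a, ⟨a, ha, rfl⟩, ?_⟩
    rintro ⟨s, hs', hsa⟩
    have := h s hs'
    have := (hπ.2 s a).1 hsa
    have := (hs.2.2.2.1 a ha).2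
    grind
  obtain ⟨⟨a, ha⟩, -, hc, hd, -, hn⟩ := hs
  have hN : G.neighborSet a ⊆ S := by
    intro n hna
    have h1 : G.Adj a n := hna
    have h2 := h1.ne
    have := hsub n
    have := hsub a ha
    rcases hc n with h | h | h
    · grind
    · exact absurd h1 (hn a ha n h)
    · exact h
  have h1 := Set.ncard_le_ncard hN
  have h2 := hsub a ha
  grind

theorem IsSeparation.image {V W : Type*} [Finite V] {G : SimpleGraph V} {H : SimpleGraph W}
    {π : V → W} {u v : V} (hπ : IdentifiesOnly π u v) {S A B : Set V} (hs : IsSeparation G S A B)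
    (hH : ∀ a b, H.Adj a b → ∃ x y, π x = a ∧ π y = b ∧ G.Adj x y) (huv : G.Adj u v)
    (hu : S.ncard < (G.neighborSet u).ncard) (hv : S.ncard < (G.neighborSet v).ncard) :
    IsSeparation H (π '' S) (π '' A \ π '' S) (π '' B \ π '' S) := by
  refine ⟨hs.exists_notMem_image hπ hu hv, hs.symm.exists_notMem_image hπ hu hv, ?_, ?_, ?_, ?_⟩
  · intro a
    obtain ⟨x, rfl⟩ := hπ.1 a
    by_cases hx : π x ∈ π '' S
    · exact Or.inr (Or.inr hx)
    · rcases hs.2.2.1 x with h | h | h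
      · exact Or.inl ⟨⟨x, h, rfl⟩, hx⟩
      · exact Or.inr (Or.inl ⟨⟨x, h, rfl⟩, hx⟩)
      · exact absurd ⟨x, h, rfl⟩ hx
  · rintro _ ⟨⟨x, hx, rfl⟩, hxS⟩
    refine ⟨?_, hxS⟩
    rintro ⟨⟨y, hy, hyx⟩, -⟩
    have h1 := (hπ.2 y x).1 hyx
    have h2 := hs.2.2.2.2.2 x hx y hy
    have h3 := (hs.2.2.2.1 x hx).1
    have h4 := huv.symm
    grind
  · exact fun x hx => hx.2
  · rintro _ ⟨⟨x, hx, rfl⟩, hxS⟩ _ ⟨⟨y, hy, rfl⟩, hyS⟩ hxy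
    obtain ⟨x', y', hx', hy', hadj⟩ := hH _ _ hxy
    have h1 := (hπ.2 _ _).1 hx'
    have h2 := (hπ.2 _ _).1 hy'
    have hS : ∀ z, π z ∉ π '' S → z ∉ S := fun z hz h => hz ⟨z, h, rfl⟩
    have h3 := hS x' (hx' ▸ hxS)
    have h4 := hS y' (hy' ▸ hyS)
    have h5 := hs.2.2.2.2.2 u
    have h6 := hs.2.2.2.2.2 v
    have h7 := huv.symm
    have h8 := hs.2.2.2.2.2 x'
    have h9 := hs.2.2.1 x'
    have h10 := hs.2.2.1 y'
    have h11 := hs.2.2.2.1 x hx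
    have h12 := hs.2.2.2.1 y'
    have h13 := hs.2.2.2.1 y
    have h14 : x' ∈ A := by grind
    have h15 : y' ∈ B := by grind
    exact h8 h14 y' h15 hadj

theorem IdentifiesOnly.card_lt_card_add_two {V W : Type*} [Finite V] {π : V → W} {u v : V}
    (hπ : IdentifiesOnly π u v) : Nat.card V < Nat.card W + 2 := by
  have : Finite W := Finite.of_surjective π hπ.1
  have h1 : (π '' {v}ᶜ).ncard = ({v}ᶜ : Set V).ncard := by
    apply Set.InjOn.ncard_image
    intro x hx y hy hxy
    have := (hπ.2 x y).1 hxy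
    grind
  have h2 := Set.ncard_le_card (π '' {v}ᶜ)
  have h3 := Set.ncard_add_ncard_compl ({v} : Set V)
  rw [Set.ncard_singleton] at h3
  omega

theorem ncard_neighborSet_lt_card {V : Type*} [Finite V] (G : SimpleGraph V) (u : V) :
    (G.neighborSet u).ncard < Nat.card V := by
  rw [← Set.ncard_univ]
  exact Set.ncard_lt_ncard (Set.ssubset_univ_iff.2 fun h =>
    G.irrefl (h ▸ Set.mem_univ u : u ∈ G.neighborSet u))

theorem MinimallyKConnected.kConnected_identifyAlong {V W : Type*} [Finite V]
    {G : SimpleGraph V} (hG : MinimallyKConnected 3 G) {π : V → W} {u v : V}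
    (hπ : IdentifiesOnly π u v) (huv : G.Adj u v) (hu : 3 < (G.neighborSet u).ncard)
    (hv : 3 < (G.neighborSet v).ncard) : KConnected 3 (identifyAlong π G) := by
  have : Finite W := Finite.of_surjective π hπ.1
  have h1 := hπ.card_lt_card_add_two
  have h2 := ncard_neighborSet_lt_card G u
  refine kConnected_iff_isSeparation.2 ⟨by omega, fun S A B hs => ?_⟩
  have hs' := hs.preimage hπ.1
  by_contra! hS
  by_cases huS : π u ∈ S
  · obtain ⟨w, rfl⟩ := Set.exists_eq_pair_of_ncard_lt_three hS huS
    obtain ⟨w, rfl⟩ := hπ.1 w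
    refine hG.1.not_isSeparation_insert (hG.2 s(u, v) huv) hu hv w (π ⁻¹' A) (π ⁻¹' B) ?_
    convert hs' using 1
    ext x
    simp only [Set.mem_insert_iff, Set.mem_singleton_iff, Set.mem_preimage, hπ.2]
    grind
  · have h3 := (kConnected_iff_isSeparation.1 hG.1).2 _ _ _ hs'
    have h4 : (π '' (π ⁻¹' S)).ncard = (π ⁻¹' S).ncard := by
      apply Set.InjOn.ncard_image
      intro x hx y hy hxy
      have h5 := (hπ.2 x y).1 hxy
      have h6 : π v = π u := (hπ.2 v u).2 (by simp)
      have h7 : π x ∈ S := hx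
      grind
    rw [Set.image_preimage_eq _ hπ.1] at h4
    omega

theorem MinimallyKConnected.identifyAlong {V W : Type*} [Finite V]
    {G : SimpleGraph V} (hG : MinimallyKConnected 3 G) {π : V → W} {u v : V}
    (hπ : IdentifiesOnly π u v) (huv : G.Adj u v) (hu : 3 < (G.neighborSet u).ncard)
    (hv : 3 < (G.neighborSet v).ncard) : MinimallyKConnected 3 (identifyAlong π G) := by
  refine ⟨hG.kConnected_identifyAlong hπ huv hu hv, fun e he => ?_⟩
  induction e with | _ a b
  obtain ⟨hab, x, y, rfl, rfl, hxy⟩ := he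
  intro hcon
  obtain ⟨S, A, B, hs, -, -, hS⟩ := hG.1.exists_isSeparation_deleteEdges (hG.2 s(x, y) hxy)
  have hdeg : ∀ z, 3 < (G.neighborSet z).ncard →
      S.ncard < ((G.deleteEdges {s(x, y)}).neighborSet z).ncard := by
    intro z hz
    have hsub : ∃ t, G.neighborSet z ⊆ insert t ((G.deleteEdges {s(x, y)}).neighborSet z) := by
      classical
      refine ⟨if z = x then y else x, fun n hn => ?_⟩
      have h1 : G.Adj z n := hn
      by_cases h2 : s(z, n) = s(x, y)
      · rw [Sym2.eq_iff] at h2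
        grind
      · exact Or.inr (deleteEdges_adj.2 ⟨h1, h2⟩)
    obtain ⟨t, ht⟩ := hsub
    have h3 := Set.ncard_le_ncard ht
    have h4 := Set.ncard_insert_le t ((G.deleteEdges {s(x, y)}).neighborSet z)
    omega
  have h1 := (kConnected_iff_isSeparation.1 hcon).2 _ _ _ (hs.image hπ ?_ ?_ (hdeg u hu) (hdeg v hv))
  · have h2 := Set.ncard_image_le (f := π) S.toFinite
    omega
  · intro a b hab
    rw [deleteEdges_adj] at hab
    obtain ⟨⟨-, x', y', rfl, rfl, h⟩, hne⟩ := hab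
    refine ⟨x', y', rfl, rfl, deleteEdges_adj.2 ⟨h, fun h' => hne ?_⟩⟩
    simp only [Set.mem_singleton_iff] at h' ⊢
    have := congrArg (Sym2.map π) h'
    simpa using this
  · rw [deleteEdges_adj]
    refine ⟨huv, fun h => hab ?_⟩
    rw [Set.mem_singleton_iff, Sym2.eq_iff] at h
    rw [hπ.2]
    grind

theorem CriticallyKConnected.identifyAlong {V W : Type*} [Finite V]
    {G : SimpleGraph V} (hG : CriticallyKConnected 3 G) {π : V → W} {u v : V}
    (hπ : IdentifiesOnly π u v) (hconn : KConnected 3 (identifyAlong π G)) (huv : G.Adj u v)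
    (hu : 3 < (G.neighborSet u).ncard) (hv : 3 < (G.neighborSet v).ncard) :
    CriticallyKConnected 3 (identifyAlong π G) := by
  have : Finite W := Finite.of_surjective π hπ.1
  refine ⟨hconn, fun w hw => ?_⟩
  obtain ⟨z, rfl⟩ := hπ.1 w
  apply hG.2 z
  rw [kConnected_induce_compl_singleton_iff] at hw ⊢
  have h2 := ncard_neighborSet_lt_card G u
  refine ⟨by omega, fun S A B hs hz => ?_⟩
  by_contra! hS
  have h3 := hw.2 _ _ _ (hs.image hπ (fun a b h => h.2) huv (by omega) (by omega)) ⟨z, hz, rfl⟩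
  have h4 := Set.ncard_image_le (f := π) S.toFinite
  omega

theorem MinimallyKConnected.eq_of_identifiesOnly {V W : Type*} [Finite V]
    {G : SimpleGraph V} (hG : MinimallyKConnected 3 G) {π : V → W} {u v : V}
    (hπ : IdentifiesOnly π u v) (huv : G.Adj u v) (hu : 3 < (G.neighborSet u).ncard)
    (hv : 3 < (G.neighborSet v).ncard) {x y x' y' : V} (hxy : G.Adj x y) (hxy' : G.Adj x' y')
    (hx : π x = π x') (hy : π y = π y') (hne : π x ≠ π y) : x = x' ∧ y = y' := by
  have htri : ∀ z, G.Adj u z → ¬ G.Adj v z := fun z hz => hG.not_triangle hu hv huv hz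
  have h1 := hxy.symm
  have h2 := hxy'.symm
  rw [hπ.2] at hx hy
  rw [Ne, hπ.2] at hne
  grind

theorem MinimallyKConnected.three_lt_degree_identifyAlong {V W : Type*} [Finite V]
    {G : SimpleGraph V} (hG : MinimallyKConnected 3 G) {π : V → W} {u v : V}
    (hπ : IdentifiesOnly π u v) (huv : G.Adj u v) (hu : 3 < (G.neighborSet u).ncard)
    (hv : 3 < (G.neighborSet v).ncard) {x : V} (hx : 3 < (G.neighborSet x).ncard) :
    3 < ((_root_.identifyAlong π G).neighborSet (π x)).ncard := by
  have : Finite W := Finite.of_surjective π hπ.1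
  have hπuv : π u = π v := (hπ.2 u v).2 (by simp)
  by_cases hxuv : x = u ∨ x = v
  · have hxu : π x = π u := by grind
    rw [hxu]
    obtain ⟨t, ht, htu⟩ : ∃ t, G.Adj v t ∧ t ≠ u := by
      by_contra! h
      have hsub : G.neighborSet v ⊆ {u} := fun y hy => h y hy
      have := Set.ncard_le_ncard hsub
      rw [Set.ncard_singleton] at this
      omega
    have hne : ∀ n, G.Adj u n → n ≠ v → π u ≠ π n := by
      intro n hn hnv h
      have := hn.ne
      have := (hπ.2 u n).1 h
      grind
    have hinj : Set.InjOn π (G.neighborSet u \ {v}) := by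
      rintro a ⟨ha, hav⟩ b ⟨hb, hbv⟩ hab
      exact (hG.eq_of_identifiesOnly hπ huv hu hv ha hb rfl hab (hne a ha hav)).2
    have hnot : π t ∉ π '' (G.neighborSet u \ {v}) := by
      rintro ⟨n, ⟨hn, hnv⟩, hnt⟩
      exact huv.ne (hG.eq_of_identifiesOnly hπ huv hu hv hn ht hπuv hnt (hne n hn hnv)).1
    have hsub : insert (π t) (π '' (G.neighborSet u \ {v})) ⊆
        (_root_.identifyAlong π G).neighborSet (π u) := by
      rw [Set.insert_subset_iff]
      refine ⟨⟨fun h => ?_, v, t, hπuv.symm, rfl, ht⟩, ?_⟩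
      · have := (hπ.2 u t).1 h
        have := ht.ne
        grind
      · rintro _ ⟨n, ⟨hn, hnv⟩, rfl⟩
        exact ⟨hne n hn hnv, u, n, rfl, rfl, hn⟩
    have h1 := Set.ncard_le_ncard hsub
    rw [Set.ncard_insert_of_notMem hnot, hinj.ncard_image] at h1
    have h2 := Set.ncard_sdiff_singleton_add_one (show v ∈ G.neighborSet u from huv)
    omega
  · have hne : ∀ n, G.Adj x n → π x ≠ π n := by
      intro n hn h
      have := hn.ne
      have := (hπ.2 x n).1 h
      grind
    have hinj : Set.InjOn π (G.neighborSet x) := by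
      intro a ha b hb hab
      exact (hG.eq_of_identifiesOnly hπ huv hu hv ha hb rfl hab (hne a ha)).2
    have hsub : π '' G.neighborSet x ⊆ (_root_.identifyAlong π G).neighborSet (π x) := by
      rintro _ ⟨n, hn, rfl⟩
      exact ⟨hne n hn, x, n, rfl, rfl, hn⟩
    have h1 := Set.ncard_le_ncard hsub
    rw [hinj.ncard_image] at h1
    omega

theorem exists_identifiesOnly {V : Type*} [Finite V] {u v : V} (huv : u ≠ v) :
    ∃ π : V → {x : V // x ≠ v}, IdentifiesOnly π u v := by
  classical
  refine ⟨fun x => if h : x = v then ⟨u, huv⟩ else ⟨x, h⟩, fun x => ⟨x, by simp [x.2]⟩,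
    fun x y => ?_⟩
  by_cases hx : x = v <;> by_cases hy : y = v <;>
    simp only [hx, hy, dite_true, dite_false, Subtype.mk.injEq] <;> grind

theorem IsSeparation.image_equiv {V W : Type*} {G : SimpleGraph V} {H : SimpleGraph W}
    (φ : G ≃g H) {S A B : Set V} (hs : IsSeparation G S A B) :
    IsSeparation H (φ '' S) (φ '' A) (φ '' B) := by
  have hi := φ.injective
  obtain ⟨hA, hB, hc, hd, he, hn⟩ := hs
  refine ⟨hA.image _, hB.image _, fun x => ?_, ?_, ?_, ?_⟩
  · obtain ⟨x, rfl⟩ := φ.surjective x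
    simpa only [hi.mem_set_image] using hc x
  · rintro _ ⟨x, hx, rfl⟩
    simpa only [hi.mem_set_image] using hd x hx
  · rintro _ ⟨x, hx, rfl⟩
    simpa only [hi.mem_set_image] using he x hx
  · rintro _ ⟨x, hx, rfl⟩ _ ⟨y, hy, rfl⟩
    rw [φ.map_adj_iff]
    exact hn x hx y hy

theorem KConnected.of_iso {V W : Type*} {k : ℕ} {G : SimpleGraph V} {H : SimpleGraph W}
    (φ : G ≃g H) (hG : KConnected k H) : KConnected k G := by
  rw [kConnected_iff_isSeparation] at hG ⊢
  rw [Nat.card_congr φ.toEquiv]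
  refine ⟨hG.1, fun S A B hs => ?_⟩
  rw [← Set.ncard_image_of_injective S φ.injective]
  exact hG.2 _ _ _ (hs.image_equiv φ)

theorem MinimallyKConnected.of_iso {V W : Type*} {k : ℕ} {G : SimpleGraph V}
    {H : SimpleGraph W} (φ : G ≃g H) (hG : MinimallyKConnected k H) :
    MinimallyKConnected k G := by
  refine ⟨hG.1.of_iso φ, fun e he h => ?_⟩
  induction e with | _ x y
  refine hG.2 s(φ x, φ y) (φ.map_adj_iff.2 he) (h.of_iso (RelIso.symm ⟨φ.toEquiv, ?_⟩))
  intro a b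
  change (H.deleteEdges _).Adj (φ a) (φ b) ↔ _
  rw [deleteEdges_adj, deleteEdges_adj, φ.map_adj_iff]
  simp only [Set.mem_singleton_iff, Sym2.eq_iff, φ.injective.eq_iff]

theorem CriticallyKConnected.of_iso {V W : Type*} [Finite V] {k : ℕ} {G : SimpleGraph V}
    {H : SimpleGraph W} (φ : G ≃g H) (hG : CriticallyKConnected k H) :
    CriticallyKConnected k G := by
  have : Finite W := Finite.of_surjective φ φ.surjective
  refine ⟨hG.1.of_iso φ, fun z h => hG.2 (φ z) ?_⟩
  rw [kConnected_induce_compl_singleton_iff] at h ⊢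
  rw [← Nat.card_congr φ.toEquiv]
  refine ⟨h.1, fun S A B hs hz => ?_⟩
  rw [← Set.ncard_image_of_injective S φ.symm.injective]
  exact h.2 _ _ _ (hs.image_equiv φ.symm) ⟨_, hz, φ.symm_apply_apply z⟩

theorem contract_subgraph_high_degree {W : Type*} (n : ℕ) : ∀ {V : Type*} [Finite V]
    (G F : SimpleGraph V) (f : V → W), Nat.card V = n → MinimallyKConnected 3 G →
    CriticallyKConnected 3 G → F ≤ G →
    (∀ x y, F.Adj x y → 3 < (G.neighborSet x).ncard ∧ 3 < (G.neighborSet y).ncard) →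
    Function.Surjective f → (∀ v w, f v = f w ↔ F.Reachable v w) →
    (∀ v w, G.Adj v w → f v = f w → F.Adj v w) ∧
    (∀ v₁ w₁ v₂ w₂ : V, G.Adj v₁ w₁ → ¬ F.Adj v₁ w₁ → G.Adj v₂ w₂ → ¬ F.Adj v₂ w₂ →
      f v₁ = f v₂ → f w₁ = f w₂ → s(v₁, w₁) = s(v₂, w₂)) ∧
    MinimallyKConnected 3 (identifyAlong f G) ∧ CriticallyKConnected 3 (identifyAlong f G) := by
  induction n using Nat.strong_induction_on with | _ n ih
  intro V _ G F f hn hmin hcrit hFG hdeg hsurj hfib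
  by_cases hF : ∃ u v, F.Adj u v
  · obtain ⟨u, v, huvF⟩ := hF
    have huv := hFG huvF
    obtain ⟨hu, hv⟩ := hdeg u v huvF
    obtain ⟨π, hπ⟩ := exists_identifiesOnly huv.ne
    have hfuv : f u = f v := (hfib u v).2 huvF.reachable
    obtain ⟨f₁, hf₁⟩ : ∃ f₁ : {x : V // x ≠ v} → W, ∀ x, f₁ (π x) = f x := by
      refine ⟨fun a => f (Function.surjInv hπ.1 a), fun x => ?_⟩
      have := (hπ.2 _ _).1 (Function.surjInv_eq hπ.1 (π x))
      grind
    have hsimple : ∀ {x y x' y'}, G.Adj x y → G.Adj x' y' → π x = π x' → π y = π y' →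
        π x ≠ π y → x = x' ∧ y = y' := fun h h' h1 h2 h3 =>
      hmin.eq_of_identifiesOnly hπ huv hu hv h h' h1 h2 h3
    have hpush : ∀ {x y}, F.Reachable x y → (identifyAlong π F).Reachable (π x) (π y) := by
      rintro x y ⟨p⟩
      induction p with
      | nil => rfl
      | @cons x y z h p ih =>
        by_cases hxy : π x = π y
        · rwa [hxy]
        · exact (Adj.reachable (G := identifyAlong π F) ⟨hxy, x, y, rfl, rfl, h⟩).trans ih
    have hpull : ∀ {a b}, (identifyAlong π F).Reachable a b → f₁ a = f₁ b := by
      rintro a b ⟨p⟩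
      induction p with
      | nil => rfl
      | cons h p ih =>
        obtain ⟨-, x, y, rfl, rfl, h⟩ := h
        rw [← ih, hf₁, hf₁]
        exact (hfib x y).2 h.reachable
    have hnonloop : ∀ {x y}, G.Adj x y → ¬ F.Adj x y → π x ≠ π y := by
      intro x y hxy hxyF h
      have h1 := (hπ.2 x y).1 h
      have h2 := hxy.ne
      have h3 := huvF.symm
      grind
    have hF₁ : ∀ {x y}, G.Adj x y → (identifyAlong π F).Adj (π x) (π y) → F.Adj x y := by
      rintro x y hxy ⟨hne, x', y', hx, hy, h⟩
      obtain ⟨rfl, rfl⟩ := hsimple hxy (hFG h) hx.symm hy.symm hne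
      exact h
    have hG₁ : identifyAlong f₁ (identifyAlong π G) = identifyAlong f G := by
      ext a b
      simp only [identifyAlong_adj]
      refine and_congr_right fun hab => ⟨?_, ?_⟩
      · rintro ⟨_, _, h1, h2, -, x, y, rfl, rfl, h⟩
        exact ⟨x, y, by rw [← h1, hf₁], by rw [← h2, hf₁], h⟩
      · rintro ⟨x, y, rfl, rfl, h⟩
        exact ⟨π x, π y, hf₁ x, hf₁ y, fun hxy => hab (by rw [← hf₁, hxy, hf₁]), x, y, rfl, rfl, h⟩
    have hlt : Nat.card {x : V // x ≠ v} < n := by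
      rw [← hn]
      exact Finite.card_subtype_lt (x := v) (by simp)
    obtain ⟨hloop, hmult, hm, hc⟩ := ih _ hlt (identifyAlong π G) (identifyAlong π F) f₁ rfl
      (hmin.identifyAlong hπ huv hu hv)
      (hcrit.identifyAlong hπ (hmin.kConnected_identifyAlong hπ huv hu hv) huv hu hv)
      (fun a b ⟨hne, x, y, hx, hy, h⟩ => ⟨hne, x, y, hx, hy, hFG h⟩)
      (by
        rintro a b ⟨-, x, y, rfl, rfl, h⟩
        exact ⟨hmin.three_lt_degree_identifyAlong hπ huv hu hv (hdeg x y h).1,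
          hmin.three_lt_degree_identifyAlong hπ huv hu hv (hdeg x y h).2⟩)
      (fun w => by
        obtain ⟨x, rfl⟩ := hsurj w
        exact ⟨π x, hf₁ x⟩)
      (fun a b => by
        obtain ⟨x, rfl⟩ := hπ.1 a
        obtain ⟨y, rfl⟩ := hπ.1 b
        refine ⟨fun h => hpush ((hfib x y).1 ?_), hpull⟩
        rw [← hf₁, h, hf₁])
    rw [hG₁] at hm hc
    refine ⟨fun x y hxy hf => ?_, fun v₁ w₁ v₂ w₂ h₁ hF₁' h₂ hF₂' hfv hfw => ?_, hm, hc⟩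
    · by_contra hxyF
      exact hxyF (hF₁ hxy (hloop _ _ ⟨hnonloop hxy hxyF, x, y, rfl, rfl, hxy⟩
        (by rw [hf₁, hf₁, hf])))
    · have hne₁ := hnonloop h₁ hF₁'
      have hne₂ := hnonloop h₂ hF₂'
      have := hmult (π v₁) (π w₁) (π v₂) (π w₂) ⟨hne₁, _, _, rfl, rfl, h₁⟩
        (fun h => hF₁' (hF₁ h₁ h)) ⟨hne₂, _, _, rfl, rfl, h₂⟩ (fun h => hF₂' (hF₁ h₂ h))
        (by rw [hf₁, hf₁, hfv]) (by rw [hf₁, hf₁, hfw])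
      rw [Sym2.eq_iff] at this ⊢
      rcases this with ⟨h, h'⟩ | ⟨h, h'⟩
      · exact Or.inl (hsimple h₁ h₂ h h' hne₁)
      · exact Or.inr (hsimple h₁ h₂.symm h h' hne₁)
  · have hinj : Function.Injective f := by
      intro x y hxy
      obtain ⟨p⟩ := (hfib x y).1 hxy
      cases p with
      | nil => rfl
      | cons h p => exact absurd ⟨_, _, h⟩ hF
    have φ : identifyAlong f G ≃g G := by
      refine RelIso.symm ⟨Equiv.ofBijective f ⟨hinj, hsurj⟩, ?_⟩
      intro x y
      simp only [identifyAlong_adj]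
      constructor
      · rintro ⟨-, x', y', hx, hy, h⟩
        rwa [← hinj hx, ← hinj hy]
      · exact fun h => ⟨fun h' => h.ne (hinj h'), x, y, rfl, rfl, h⟩
    have : Finite W := Finite.of_surjective f hsurj
    refine ⟨fun v w h h' => absurd (hinj h') h.ne, fun v₁ w₁ v₂ w₂ _ _ _ _ hfv hfw => ?_,
      hmin.of_iso φ, hcrit.of_iso φ⟩
    rw [hinj hfv, hinj hfw]

/-- Let `G` be minimally and critically 3-connected, and let `F` be the subgraph
of `G` induced by the vertices of degree greater than three.  The contraction `G/E(F)` is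
encoded by a surjection `f : V → W` whose fibres are exactly the components of `F`, together
with the graph `G'` on `W` whose adjacency is induced by `G`-edges.  Then the contraction is
simple (it creates no loops and no multiple edges) and `G'` is both minimally and critically
3-connected. -/
theorem contract_high_degree_forest_minimally_critically {V W : Type*} [Fintype V] [Fintype W]
    (G : SimpleGraph V) (hmin : MinimallyKConnected 3 G) (hcrit : CriticallyKConnected 3 G)
    (F : SimpleGraph V)
    (hF : ∀ v w : V, F.Adj v w ↔
      G.Adj v w ∧ 3 < (G.neighborSet v).ncard ∧ 3 < (G.neighborSet w).ncard)
    (f : V → W) (hsurj : Function.Surjective f)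
    (hfib : ∀ v w : V, f v = f w ↔ F.Reachable v w)
    (G' : SimpleGraph W)
    (hadj : ∀ a b : W, G'.Adj a b ↔ a ≠ b ∧ ∃ v w : V, f v = a ∧ f w = b ∧ G.Adj v w) :
    (∀ v w : V, G.Adj v w → f v = f w → F.Adj v w) ∧
    (∀ v₁ w₁ v₂ w₂ : V, G.Adj v₁ w₁ → ¬ F.Adj v₁ w₁ → G.Adj v₂ w₂ → ¬ F.Adj v₂ w₂ →
      f v₁ = f v₂ → f w₁ = f w₂ → s(v₁, w₁) = s(v₂, w₂)) ∧
    MinimallyKConnected 3 G' ∧ CriticallyKConnected 3 G' := by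
  have hG' : G' = identifyAlong f G := by
    ext a b
    rw [hadj, identifyAlong_adj]
  rw [hG']
  exact contract_subgraph_high_degree _ G F f rfl hmin hcrit (fun v w h => ((hF v w).1 h).1)
    (fun v w h => ((hF v w).1 h).2) hsurj hfib
end

section
/- Let G be a bipartite graph with bipartition (X,Y) such that |Y| ≥ 2|X| − k for some integer k, and such that every vertex y ∈ Y has degree at least 3 in G. Suppose {A,B} is a 2-separation of G and let S = Y ∩ V(A) ∩ V(B). Then one of the two graphs A−S or B−S, call it G', is a bipartite graph with bipartition (X',Y') where X' = X ∩ V(G') and Y' = Y ∩ V(G'), satisfying |X'| < |X|, |Y'| ≥ 2|X'| − ⌊(k+4)/2⌋, and deg_G(y) = deg_{G'}(y) for every y ∈ Y'. -/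
open SimpleGraph

/-- `{A, B}` is a `k`-separation of the subgraph `K`: `A` and `B` are edge-disjoint subgraphs
whose union is `K`, sharing exactly `k` vertices, each having at least `k + 1` vertices. -/
def IsKSepPair {V : Type*} (k : ℕ) {G : SimpleGraph V} (K A B : G.Subgraph) : Prop :=
  Disjoint A.edgeSet B.edgeSet ∧ A ⊔ B = K ∧ (A.verts ∩ B.verts).ncard = k ∧
    k + 1 ≤ A.verts.ncard ∧ k + 1 ≤ B.verts.ncard

/-- `{A, B}` is a `k`-separation of the graph `G`. -/
def IsKSeparation {V : Type*} (k : ℕ) (G : SimpleGraph V) (A B : G.Subgraph) : Prop :=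
  IsKSepPair k ⊤ A B

/-- If two subgraphs covering a bipartite graph meet in fewer than `d` vertices, every vertex of
`Y` has degree at least `d`, and some vertex lies outside `C`, then `C` misses a vertex of `X`. -/
theorem exists_mem_left_notMem_verts {V : Type*} [Finite V] {G : SimpleGraph V} {X Y : Set V}
    {d : ℕ} (hcover : X ∪ Y = Set.univ)
    (hbip : ∀ v w : V, G.Adj v w → (v ∈ X ∧ w ∈ Y) ∨ (v ∈ Y ∧ w ∈ X))
    (hdeg : ∀ y ∈ Y, d ≤ (G.neighborSet y).ncard)
    {C D : G.Subgraph} (hCD : C ⊔ D = ⊤) (hcard : (C.verts ∩ D.verts).ncard < d)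
    {v : V} (hv : v ∉ C.verts) : ∃ x ∈ X, x ∉ C.verts := by
  by_contra! hX
  have hvX : v ∉ X := fun h => hv (hX v h)
  have hvY : v ∈ Y := ((hcover ▸ Set.mem_univ v : v ∈ X ∪ Y)).resolve_left hvX
  have hsub : G.neighborSet v ⊆ C.verts ∩ D.verts := by
    intro w hw
    have hadj : (C ⊔ D).Adj v w := by rw [hCD]; exact hw
    rcases hbip v w hw with h | h
    · exact absurd h.1 hvX
    · refine ⟨hX w h.2, ?_⟩
      rcases hadj with h' | h'
      · exact absurd h'.fst_mem hv
      · exact h'.snd_mem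
  exact absurd ((hdeg v hvY).trans (Set.ncard_le_ncard hsub)) (by omega)

/-- Deleting from `C` the vertices of `Y` shared with `D` preserves the neighborhoods of the
remaining vertices of `Y`, when `C` and `D` cover a bipartite graph. -/
theorem neighborSet_deleteVerts_of_sup_eq_top {V : Type*} {G : SimpleGraph V} {X Y : Set V}
    (hdisj : Disjoint X Y)
    (hbip : ∀ v w : V, G.Adj v w → (v ∈ X ∧ w ∈ Y) ∨ (v ∈ Y ∧ w ∈ X))
    {C D : G.Subgraph} (hCD : C ⊔ D = ⊤) {S : Set V} (hS : S = Y ∩ (C.verts ∩ D.verts))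
    {y : V} (hy : y ∈ Y ∩ (C.deleteVerts S).verts) :
    (C.deleteVerts S).neighborSet y = G.neighborSet y := by
  obtain ⟨hyY, hyC, hyS⟩ := hy
  refine Set.Subset.antisymm (Subgraph.neighborSet_subset _ y) fun w hw => ?_
  have hadj : (C ⊔ D).Adj y w := by rw [hCD]; exact hw
  have hC : C.Adj y w := by
    rcases hadj with h | h
    · exact h
    · exact absurd (hS ▸ ⟨hyY, hyC, h.fst_mem⟩) hyS
  have hwY : w ∉ Y := by
    rcases hbip y w hw with h | h
    · exact absurd hyY (Set.disjoint_left.mp hdisj h.1)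
    · exact Set.disjoint_left.mp hdisj h.2
  have hwS : w ∉ S := fun h => hwY (hS ▸ h : w ∈ Y ∩ (C.verts ∩ D.verts)).1
  exact Subgraph.deleteVerts_adj.mpr ⟨hyC, hyS, hC.snd_mem, hwS, hC⟩

/-- Inclusion-exclusion for the traces on `T` of two sets covering the whole type. -/
theorem ncard_inter_add_ncard_inter_of_union_eq_univ {V : Type*} [Finite V] (T : Set V)
    {P Q : Set V} (h : P ∪ Q = Set.univ) :
    (T ∩ P).ncard + (T ∩ Q).ncard = T.ncard + (T ∩ (P ∩ Q)).ncard := by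
  rw [← Set.ncard_union_add_ncard_inter, ← Set.inter_union_distrib_left, h, Set.inter_univ,
    ← Set.inter_inter_distrib_left]

/-- bipartite splitting lemma for a 2-separation (Lemma 3.1 of the paper). -/
theorem bipartite_two_separation_lemma {V : Type*} [Fintype V] (G : SimpleGraph V)
    (X Y : Set V) (k : ℤ)
    (hdisj : Disjoint X Y) (hcover : X ∪ Y = Set.univ)
    (hbip : ∀ v w : V, G.Adj v w → (v ∈ X ∧ w ∈ Y) ∨ (v ∈ Y ∧ w ∈ X))
    (hY : 2 * (X.ncard : ℤ) - k ≤ (Y.ncard : ℤ))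
    (hdeg : ∀ y ∈ Y, 3 ≤ (G.neighborSet y).ncard)
    (A B : G.Subgraph) (hsep : IsKSeparation 2 G A B) :
    ∃ C : G.Subgraph, (C = A ∨ C = B) ∧
      (X ∩ (C.deleteVerts (Y ∩ A.verts ∩ B.verts)).verts).ncard < X.ncard ∧
      2 * ((X ∩ (C.deleteVerts (Y ∩ A.verts ∩ B.verts)).verts).ncard : ℤ) -
          Int.fdiv (k + 4) 2 ≤
        ((Y ∩ (C.deleteVerts (Y ∩ A.verts ∩ B.verts)).verts).ncard : ℤ) ∧
      ∀ y ∈ Y ∩ (C.deleteVerts (Y ∩ A.verts ∩ B.verts)).verts,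
        ((C.deleteVerts (Y ∩ A.verts ∩ B.verts)).neighborSet y).ncard =
          (G.neighborSet y).ncard := by
  obtain ⟨-, hAB, hcard, hA, hB⟩ := hsep
  have hBA : B ⊔ A = ⊤ := by rw [sup_comm, hAB]
  have hverts : A.verts ∪ B.verts = Set.univ := by
    rw [← Subgraph.verts_sup, hAB, Subgraph.verts_top]
  have hcard' : (B.verts ∩ A.verts).ncard = 2 := by rw [Set.inter_comm, hcard]
  obtain ⟨S, hS⟩ : ∃ S, S = Y ∩ (A.verts ∩ B.verts) := ⟨_, rfl⟩
  have hS' : S = Y ∩ (B.verts ∩ A.verts) := by rw [hS, Set.inter_comm B.verts]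
  rw [Set.inter_assoc, ← hS]
  have hX (C : G.Subgraph) : X ∩ (C.deleteVerts S).verts = X ∩ C.verts := by
    ext v
    have : v ∈ X → v ∉ Y := fun h => Set.disjoint_left.mp hdisj h
    simp only [Subgraph.deleteVerts_verts, Set.mem_inter_iff, Set.mem_sdiff, hS]
    tauto
  have hYC (C : G.Subgraph) (hSC : S ⊆ Y ∩ C.verts) :
      (Y ∩ (C.deleteVerts S).verts).ncard + S.ncard = (Y ∩ C.verts).ncard := by
    rw [Subgraph.deleteVerts_verts, ← Set.inter_sdiff_assoc]
    exact Set.ncard_sdiff_add_ncard_of_subset hSC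
  have hYA := hYC A fun v hv => by rw [hS] at hv; exact ⟨hv.1, hv.2.1⟩
  have hYB := hYC B fun v hv => by rw [hS] at hv; exact ⟨hv.1, hv.2.2⟩
  have hsumX := ncard_inter_add_ncard_inter_of_union_eq_univ X hverts
  have hsumY := ncard_inter_add_ncard_inter_of_union_eq_univ Y hverts
  have hXS : (X ∩ (A.verts ∩ B.verts)).ncard + S.ncard = 2 := by
    rw [← hcard, hS, ← Set.ncard_union_eq (hdisj.mono Set.inter_subset_left Set.inter_subset_left),
      ← Set.union_inter_distrib_right, hcover, Set.univ_inter]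
  rw [← hS] at hsumY
  have hlt {C D : G.Subgraph} (hCD : C ⊔ D = ⊤) (hc : (C.verts ∩ D.verts).ncard = 2)
      (hD : 3 ≤ D.verts.ncard) : (X ∩ C.verts).ncard < X.ncard := by
    have hv : ∃ v, v ∉ C.verts := by
      by_contra! h
      rw [Set.eq_univ_of_forall h, Set.univ_inter] at hc
      omega
    obtain ⟨v, hv⟩ := hv
    obtain ⟨x, hx, hxC⟩ :=
      exists_mem_left_notMem_verts hcover hbip hdeg hCD (by omega) hv
    exact Set.ncard_lt_ncard ⟨Set.inter_subset_left, fun h => hxC (h hx).2⟩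
  have hXA := hlt hAB hcard hB
  have hXB := hlt hBA hcard' hA
  rw [Int.fdiv_eq_ediv_of_nonneg _ (by norm_num)]
  by_cases h : 2 * ((X ∩ A.verts).ncard : ℤ) - (k + 4) / 2 ≤ (Y ∩ (A.deleteVerts S).verts).ncard
  · refine ⟨A, .inl rfl, ?_, ?_, fun y hy => ?_⟩
    · rwa [hX]
    · rwa [hX]
    · rw [neighborSet_deleteVerts_of_sup_eq_top hdisj hbip hAB hS hy]
  · refine ⟨B, .inr rfl, ?_, ?_, fun y hy => ?_⟩
    · rwa [hX]
    · rw [hX]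
      omega
    · rw [neighborSet_deleteVerts_of_sup_eq_top hdisj hbip hBA hS' hy]
end

section
/- Let G be a semi-cubic bipartite graph with bipartition (X,Y). If |X| ≥ 3 and |Y| ≥ 2|X| − 4, then G has a subgraph H such that either (i) H is a K_{3,2}-subgraph of G, or (ii) H is 3-connected and there is a vertex h ∈ V(H) ∩ Y such that H−h is internally 3-connected. -/
open SimpleGraph

/-- A graph is internally 3-connected if it is 2-connected, has at least four vertices, and
in every 2-separation one of the two sides is isomorphic to a 3-vertex path. -/
def InternallyThreeConnected {V : Type*} (G : SimpleGraph V) : Prop :=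
  KConnected 2 G ∧ 4 ≤ Nat.card V ∧
    ∀ A B : G.Subgraph, IsKSeparation 2 G A B →
      Nonempty (A.coe ≃g pathGraph 3) ∨ Nonempty (B.coe ≃g pathGraph 3)

/-- The vertices of `Y` all of whose neighbours lie in `W`. -/
def verticesOver {V : Type*} (G : SimpleGraph V) (Y W : Set V) : Set V :=
  {y ∈ Y | G.neighborSet y ⊆ W}

/-- `W ⊆ X` is a minimal set attaining the bound `2|W| - 4` on the number of vertices of `Y` over
it, in a semi-cubic bipartite graph, and `W` has at least four vertices. -/
structure IsCritical {V : Type*} (G : SimpleGraph V) (X Y W : Set V) : Prop where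
  disjoint : Disjoint X Y
  bipartite : ∀ v w : V, G.Adj v w → (v ∈ X ∧ w ∈ Y) ∨ (v ∈ Y ∧ w ∈ X)
  semicubic : ∀ y ∈ Y, (G.neighborSet y).ncard = 3
  subset : W ⊆ X
  four_le : 4 ≤ W.ncard
  bound : 2 * W.ncard ≤ (verticesOver G Y W).ncard + 4
  minimal : ∀ W' ⊂ W, 3 ≤ W'.ncard → (verticesOver G Y W').ncard + 5 ≤ 2 * W'.ncard

/-- The vertex set of the subgraph spanned by `W` and the vertices of `Y` over it. -/
def closedOver {V : Type*} (G : SimpleGraph V) (Y W : Set V) : Set V :=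
  W ∪ verticesOver G Y W

namespace IsCritical

variable {V : Type*} {G : SimpleGraph V} {X Y W P Q S : Set V}

lemma not_adj_right (hc : IsCritical G X Y W) {x y : V} (hx : x ∈ Y) (hy : y ∈ Y) :
    ¬ G.Adj x y := by
  intro h
  rcases hc.bipartite x y h with h | h
  · exact Set.disjoint_left.1 hc.disjoint h.1 hx
  · exact Set.disjoint_left.1 hc.disjoint h.2 hy

lemma neighbor_mem (hU : P ∪ Q ∪ S = closedOver G Y W)
    (hnadj : ∀ a ∈ P, ∀ b ∈ Q, ¬ G.Adj a b) {x y : V} (hx : x ∈ P) (h : G.Adj x y)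
    (hy : y ∈ closedOver G Y W) : y ∈ P ∪ S := by
  rw [← hU] at hy
  rcases hy with (hy | hy) | hy
  · exact Or.inl hy
  · exact (hnadj x hx y hy h).elim
  · exact Or.inr hy

lemma neighborSet_subset (hc : IsCritical G X Y W) (hU : P ∪ Q ∪ S = closedOver G Y W)
    (hnadj : ∀ a ∈ P, ∀ b ∈ Q, ¬ G.Adj a b) {y : V} (hy : y ∈ P ∩ Y) :
    G.neighborSet y ⊆ (P ∪ S) ∩ W := by
  have hyU : y ∈ closedOver G Y W := hU ▸ Or.inl (Or.inl hy.1)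
  have hyW : y ∈ verticesOver G Y W := by
    rcases hyU with h | h
    · exact (Set.disjoint_left.1 hc.disjoint (hc.subset h) hy.2).elim
    · exact h
  exact fun z hz => ⟨neighbor_mem hU hnadj hy.1 hz (Or.inl (hyW.2 hz)), hyW.2 hz⟩

variable [Finite V]

lemma three_le_degree (hc : IsCritical G X Y W) {x : V} (hx : x ∈ W) :
    3 ≤ (G.neighborSet x ∩ verticesOver G Y W).ncard := by
  have hcard : (W \ {x}).ncard + 1 = W.ncard := Set.ncard_sdiff_singleton_add_one hx
  have hss : W \ {x} ⊂ W := Set.sdiff_singleton_ssubset.2 hx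
  have h4 := hc.four_le
  have hb := hc.bound
  have hm := hc.minimal _ hss (by omega)
  have hsub : verticesOver G Y W ⊆
      (G.neighborSet x ∩ verticesOver G Y W) ∪ verticesOver G Y (W \ {x}) := by
    intro y hy
    by_cases hxy : G.Adj x y
    · exact Or.inl ⟨hxy, hy⟩
    · refine Or.inr ⟨hy.1, fun z hz => ⟨hy.2 hz, ?_⟩⟩
      rintro rfl
      exact hxy (SimpleGraph.Adj.symm hz)
  have h1 := Set.ncard_le_ncard hsub
  have h2 := Set.ncard_union_le (G.neighborSet x ∩ verticesOver G Y W)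
    (verticesOver G Y (W \ {x}))
  omega

lemma three_le_of_nonempty (hc : IsCritical G X Y W) (hU : P ∪ Q ∪ S = closedOver G Y W)
    (hnadj : ∀ a ∈ P, ∀ b ∈ Q, ¬ G.Adj a b) (hne : (P ∩ Y).Nonempty) :
    3 ≤ ((P ∪ S) ∩ W).ncard := by
  obtain ⟨y, hy⟩ := hne
  rw [← hc.semicubic y hy.2]
  exact Set.ncard_le_ncard (hc.neighborSet_subset hU hnadj hy)

lemma inter_nonempty (hc : IsCritical G X Y W) (hU : P ∪ Q ∪ S = closedOver G Y W)
    (hnadj : ∀ a ∈ P, ∀ b ∈ Q, ¬ G.Adj a b) (hP : P.Nonempty) (hS : (S ∩ W).ncard ≤ 2) :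
    (P ∩ W).Nonempty := by
  by_cases hne : (P ∩ Y).Nonempty
  · have h3 := hc.three_le_of_nonempty hU hnadj hne
    rw [Set.union_inter_distrib_right] at h3
    have := Set.ncard_union_le (P ∩ W) (S ∩ W)
    exact Set.nonempty_of_ncard_ne_zero (by omega)
  · obtain ⟨x, hx⟩ := hP
    have hxU : x ∈ closedOver G Y W := hU ▸ Or.inl (Or.inl hx)
    rcases hxU with h | h
    · exact ⟨x, hx, h⟩
    · exact (hne ⟨x, hx, h.1⟩).elim

lemma ncard_side_le (hc : IsCritical G X Y W) (hU : P ∪ Q ∪ S = closedOver G Y W)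
    (hnadj : ∀ a ∈ P, ∀ b ∈ Q, ¬ G.Adj a b) (hPQ : Disjoint P Q) (hQS : Disjoint Q S)
    (hQ : (Q ∩ W).Nonempty) (h3 : 3 ≤ ((P ∪ S) ∩ W).ncard) :
    (P ∩ Y).ncard + 5 ≤ 2 * ((P ∪ S) ∩ W).ncard := by
  have hss : (P ∪ S) ∩ W ⊂ W := by
    refine ⟨Set.inter_subset_right, fun h => ?_⟩
    obtain ⟨q, hq, hqW⟩ := hQ
    rcases (h hqW).1 with h' | h'
    · exact Set.disjoint_left.1 hPQ h' hq
    · exact Set.disjoint_left.1 hQS hq h'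
  have hm := hc.minimal _ hss h3
  have : P ∩ Y ⊆ verticesOver G Y ((P ∪ S) ∩ W) :=
    fun y hy => ⟨hy.2, hc.neighborSet_subset hU hnadj hy⟩
  have := Set.ncard_le_ncard this
  omega

lemma adj_of_inter_eq_empty (hc : IsCritical G X Y W) (hU : P ∪ Q ∪ S = closedOver G Y W)
    (hnadj : ∀ a ∈ P, ∀ b ∈ Q, ¬ G.Adj a b) (hPY : P ∩ Y = ∅) {x : V} (hx : x ∈ P ∩ W)
    (hS : S.ncard ≤ 3) : S.ncard = 3 ∧ S ⊆ Y ∧ ∀ s ∈ S, G.Adj x s := by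
  have h3 := hc.three_le_degree hx.2
  have hsub : G.neighborSet x ∩ verticesOver G Y W ⊆ S := by
    rintro y ⟨hy, hyW⟩
    rcases neighbor_mem hU hnadj hx.1 hy (Or.inr hyW) with h | h
    · exact (Set.eq_empty_iff_forall_notMem.1 hPY y ⟨h, hyW.1⟩).elim
    · exact h
  have heq := Set.eq_of_subset_of_ncard_le hsub (by omega)
  have hle := Set.ncard_le_ncard hsub
  refine ⟨by omega, ?_, ?_⟩
  · rw [← heq]
    exact fun y hy => hy.2.1
  · rw [← heq]
    exact fun y hy => hy.1

/-- A separation of the critical subgraph of order at most three, which has a vertex of `Y` in its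
separator if the order is three, isolates a single vertex of `X`. -/
theorem separation (hc : IsCritical G X Y W) (hU : P ∪ Q ∪ S = closedOver G Y W)
    (hnadj : ∀ a ∈ P, ∀ b ∈ Q, ¬ G.Adj a b) (hPQ : Disjoint P Q) (hPS : Disjoint P S)
    (hQS : Disjoint Q S) (hP : P.Nonempty) (hQ : Q.Nonempty) (hS : S.ncard ≤ 3)
    (hSY : S.ncard = 3 → (S ∩ Y).Nonempty) :
    S.ncard = 3 ∧ S ⊆ Y ∧ ∃ x, (P = {x} ∨ Q = {x}) ∧ ∀ s ∈ S, G.Adj x s := by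
  have hU' : Q ∪ P ∪ S = closedOver G Y W := by rw [Set.union_comm Q P, hU]
  have hnadj' : ∀ a ∈ Q, ∀ b ∈ P, ¬ G.Adj a b := fun a ha b hb h => hnadj b hb a ha h.symm
  have hWY : Disjoint W Y := hc.disjoint.mono_left hc.subset
  have hsplit : ∀ T ⊆ closedOver G Y W, T.ncard = (T ∩ W).ncard + (T ∩ Y).ncard := by
    intro T hT
    rw [← Set.ncard_union_eq (hWY.mono Set.inter_subset_right Set.inter_subset_right),
      ← Set.inter_union_distrib_left]
    congr 1
    refine (Set.inter_eq_left.2 fun z hz => ?_).symm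
    rcases hT hz with h | h
    · exact Or.inl h
    · exact Or.inr h.1
  have hPU : P ⊆ closedOver G Y W := hU ▸ fun _ h => Or.inl (Or.inl h)
  have hQU : Q ⊆ closedOver G Y W := hU ▸ fun _ h => Or.inl (Or.inr h)
  have hSU : S ⊆ closedOver G Y W := hU ▸ fun _ h => Or.inr h
  have hcP := hsplit P hPU
  have hcQ := hsplit Q hQU
  have hcS := hsplit S hSU
  have hparts : ∀ T : Set V, ((P ∪ Q ∪ S) ∩ T).ncard =
      (P ∩ T).ncard + (Q ∩ T).ncard + (S ∩ T).ncard := by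
    intro T
    rw [Set.union_inter_distrib_right,
      Set.ncard_union_eq ((hPS.union_left hQS).mono Set.inter_subset_left Set.inter_subset_left),
      Set.union_inter_distrib_right,
      Set.ncard_union_eq (hPQ.mono Set.inter_subset_left Set.inter_subset_left)]
  have hn := hparts W
  have hm := hparts Y
  have hWeq : (P ∪ Q ∪ S) ∩ W = W := by
    rw [hU]
    exact Set.inter_eq_right.2 Set.subset_union_left
  have hYeq : (P ∪ Q ∪ S) ∩ Y = verticesOver G Y W := by
    rw [hU, closedOver, Set.union_inter_distrib_right, hWY.inter_eq, Set.empty_union]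
    exact Set.inter_eq_left.2 fun y hy => hy.1
  rw [hWeq] at hn
  rw [hYeq] at hm
  have hSW : (S ∩ W).ncard ≤ 2 := by
    by_contra hlt
    have := (hSY (by omega))
    rw [← Set.ncard_pos] at this
    omega
  have hPW := hc.inter_nonempty hU hnadj hP hSW
  have hQW := hc.inter_nonempty hU' hnadj' hQ hSW
  have hPSW : ((P ∪ S) ∩ W).ncard = (P ∩ W).ncard + (S ∩ W).ncard := by
    rw [Set.union_inter_distrib_right,
      Set.ncard_union_eq (hPS.mono Set.inter_subset_left Set.inter_subset_left)]
  have hQSW : ((Q ∪ S) ∩ W).ncard = (Q ∩ W).ncard + (S ∩ W).ncard := by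
    rw [Set.union_inter_distrib_right,
      Set.ncard_union_eq (hQS.mono Set.inter_subset_left Set.inter_subset_left)]
  have hb := hc.bound
  have h4 := hc.four_le
  have hPbound := hc.ncard_side_le hU hnadj hPQ hQS hQW
  have hQbound := hc.ncard_side_le hU' hnadj' hPQ.symm hPS hPW
  rw [hPSW] at hPbound
  rw [hQSW] at hQbound
  have hpos := hPW.ncard_pos
  have hqos := hQW.ncard_pos
  rcases Set.eq_empty_or_nonempty (P ∩ Y) with hPY | hPY
  · obtain ⟨x, hx⟩ := hPW
    obtain ⟨h1, h2, h3⟩ := hc.adj_of_inter_eq_empty hU hnadj hPY hx hS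
    have hSY3 : S ∩ Y = S := Set.inter_eq_left.2 h2
    rw [hSY3] at hcS hm
    rw [hPY, Set.ncard_empty] at hcP hm
    rcases Set.eq_empty_or_nonempty (Q ∩ Y) with hQY | hQY
    · rw [hQY, Set.ncard_empty] at hm
      omega
    · have hq3 := hc.three_le_of_nonempty hU' hnadj' hQY
      obtain ⟨x', hx'⟩ := Set.ncard_eq_one.1 (show P.ncard = 1 by omega)
      obtain rfl : x = x' := by simpa [hx'] using hx.1
      exact ⟨h1, h2, x, Or.inl hx', h3⟩
  · have hp3 := hc.three_le_of_nonempty hU hnadj hPY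
    rcases Set.eq_empty_or_nonempty (Q ∩ Y) with hQY | hQY
    · obtain ⟨x, hx⟩ := hQW
      obtain ⟨h1, h2, h3⟩ := hc.adj_of_inter_eq_empty hU' hnadj' hQY hx hS
      have hSY3 : S ∩ Y = S := Set.inter_eq_left.2 h2
      rw [hSY3] at hcS hm
      rw [hQY, Set.ncard_empty] at hcQ hm
      obtain ⟨x', hx'⟩ := Set.ncard_eq_one.1 (show Q.ncard = 1 by omega)
      obtain rfl : x = x' := by simpa [hx'] using hx.1
      exact ⟨h1, h2, x, Or.inr hx', h3⟩
    · have hq3 := hc.three_le_of_nonempty hU' hnadj' hQY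
      have hSYpos : S.ncard = 3 → 0 < (S ∩ Y).ncard := fun h => (hSY h).ncard_pos
      omega

lemma eight_le_ncard (hc : IsCritical G X Y W) : 8 ≤ (closedOver G Y W).ncard := by
  have hd : Disjoint W (verticesOver G Y W) :=
    hc.disjoint.mono hc.subset fun y hy => hy.1
  have := hc.bound
  have := hc.four_le
  rw [closedOver, Set.ncard_union_eq hd]
  omega

/-- Deleting at most two vertices from the critical subgraph leaves a connected graph. -/
theorem connected_of_range_eq (hc : IsCritical G X Y W) {T : Type*} {K : SimpleGraph T}
    (f : T → V) (hf : Function.Injective f) (hadj : ∀ a b, G.Adj (f a) (f b) → K.Adj a b)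
    (hS : S.ncard ≤ 2) (hSU : S ⊆ closedOver G Y W)
    (hrange : Set.range f = closedOver G Y W \ S) : K.Connected := by
  have h8 := hc.eight_le_ncard
  have hne : Nonempty T := by
    rw [← Set.range_nonempty_iff_nonempty (f := f), hrange]
    have := Set.ncard_sdiff_add_ncard_of_subset hSU
    exact Set.nonempty_of_ncard_ne_zero (by omega)
  refine { preconnected := ?_, nonempty := hne }
  intro a b
  by_contra hab
  let R : Set T := {c | K.Reachable a c}
  have hdis : ∀ A : Set T, Disjoint (f '' A) S := by
    intro A
    refine Set.disjoint_left.2 ?_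
    rintro _ ⟨c, -, rfl⟩ hcS
    have : f c ∈ Set.range f := ⟨c, rfl⟩
    rw [hrange] at this
    exact this.2 hcS
  have hU : f '' R ∪ f '' Rᶜ ∪ S = closedOver G Y W := by
    rw [← Set.image_union, Set.union_compl_self, Set.image_univ, hrange,
      Set.sdiff_union_of_subset hSU]
  have hnadj : ∀ p ∈ f '' R, ∀ q ∈ f '' Rᶜ, ¬ G.Adj p q := by
    rintro _ ⟨c, hcR, rfl⟩ _ ⟨d, hdR, rfl⟩ h
    exact hdR (SimpleGraph.Reachable.trans hcR (hadj c d h).reachable)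
  have := hc.separation hU hnadj ((Set.disjoint_image_iff hf).2 disjoint_compl_right)
    (hdis _) (hdis _) ⟨f a, a, SimpleGraph.Reachable.refl a, rfl⟩ ⟨f b, b, hab, rfl⟩
    (by omega) (by omega)
  omega

end IsCritical

lemma nonempty_iso_pathGraph_three {T : Type*} (K : SimpleGraph T) (a u v : T) (huv : u ≠ v)
    (hau : K.Adj a u) (hav : K.Adj a v) (hnuv : ¬ K.Adj u v)
    (hall : ∀ t, t = a ∨ t = u ∨ t = v) : Nonempty (K ≃g pathGraph 3) := by
  have hbij : Function.Bijective ![u, a, v] := by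
    constructor
    · intro i j hij
      have h1 := hau.ne
      have h2 := hav.ne
      fin_cases i <;> fin_cases j <;> simp_all
    · intro t
      rcases hall t with rfl | rfl | rfl
      · exact ⟨1, rfl⟩
      · exact ⟨0, rfl⟩
      · exact ⟨2, rfl⟩
  refine ⟨SimpleGraph.Iso.symm ⟨Equiv.ofBijective _ hbij, ?_⟩⟩
  intro i j
  have hnvu : ¬ K.Adj v u := fun h => hnuv h.symm
  fin_cases i <;> fin_cases j <;>
    simp [pathGraph_adj, hau, hav, hau.symm, hav.symm, hnuv, hnvu]

lemma nonempty_iso_completeBipartiteGraph {T : Type*} (K : SimpleGraph T) (A B : Set T)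
    (hAB : Disjoint A B) (hcover : A ∪ B = Set.univ) {m n : ℕ} (hA : Nat.card A = m)
    (hB : Nat.card B = n) (hm : m ≠ 0) (hn : n ≠ 0) (hAA : ∀ a ∈ A, ∀ b ∈ A, ¬ K.Adj a b)
    (hBB : ∀ a ∈ B, ∀ b ∈ B, ¬ K.Adj a b) (hABadj : ∀ a ∈ A, ∀ b ∈ B, K.Adj a b) :
    Nonempty (K ≃g completeBipartiteGraph (Fin m) (Fin n)) := by
  have : Finite A := Nat.finite_of_card_ne_zero (hA ▸ hm)
  have : Finite B := Nat.finite_of_card_ne_zero (hB ▸ hn)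
  let eA : Fin m ≃ A := (Finite.equivFinOfCardEq hA).symm
  let eB : Fin n ≃ B := (Finite.equivFinOfCardEq hB).symm
  let f : Fin m ⊕ Fin n → T := Sum.elim (fun i => eA i) (fun j => eB j)
  have hbij : Function.Bijective f := by
    constructor
    · refine Function.Injective.sumElim (Subtype.val_injective.comp eA.injective)
        (Subtype.val_injective.comp eB.injective) ?_
      intro i j h
      refine Set.disjoint_left.1 hAB (eA i).2 ?_
      rw [h]
      exact (eB j).2
    · intro t
      rcases (hcover ▸ Set.mem_univ t : t ∈ A ∪ B) with h | h
      · exact ⟨Sum.inl (eA.symm ⟨t, h⟩), by simp [f]⟩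
      · exact ⟨Sum.inr (eB.symm ⟨t, h⟩), by simp [f]⟩
  refine ⟨SimpleGraph.Iso.symm ⟨Equiv.ofBijective f hbij, ?_⟩⟩
  rintro (i | i) (j | j)
  · simpa [f] using hAA _ (eA i).2 _ (eA j).2
  · simpa [f] using hABadj _ (eA i).2 _ (eB j).2
  · simpa [f] using (hABadj _ (eA j).2 _ (eB i).2).symm
  · simpa [f] using hBB _ (eB i).2 _ (eB j).2

namespace IsCritical

variable {V : Type*} {G : SimpleGraph V} {X Y W : Set V}

/-- If a side of a `2`-separation of the critical subgraph minus `h` has only one inner vertex,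
adjacent to both vertices of the separator, then this side is a path. -/
lemma nonempty_iso_path_of_side (hc : IsCritical G X Y W) {T : Type*} {K : SimpleGraph T}
    (f : T → V) (hf : Function.Injective f) (hadj : ∀ a b, G.Adj (f a) (f b) ↔ K.Adj a b)
    {A B : K.Subgraph} (hAB : A ⊔ B = ⊤) (h2 : (A.verts ∩ B.verts).ncard = 2)
    (hY : f '' (A.verts ∩ B.verts) ⊆ Y) {x : V} (hx : f '' (A.verts \ B.verts) = {x})
    (hxadj : ∀ s ∈ f '' (A.verts ∩ B.verts), G.Adj x s) :
    Nonempty (A.coe ≃g pathGraph 3) := by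
  obtain ⟨a, haAB, rfl⟩ : x ∈ f '' (A.verts \ B.verts) := hx ▸ rfl
  obtain ⟨u, v, huv, hS⟩ := Set.ncard_eq_two.1 h2
  have hu : u ∈ A.verts ∩ B.verts := hS ▸ Or.inl rfl
  have hv : v ∈ A.verts ∩ B.verts := hS ▸ Or.inr rfl
  have hside : ∀ w ∈ A.verts ∩ B.verts, A.Adj a w := by
    intro w hw
    have hK : (⊤ : K.Subgraph).Adj a w := (hadj a w).1 (hxadj _ ⟨w, hw, rfl⟩)
    rw [← hAB, Subgraph.sup_adj] at hK
    rcases hK with h | h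
    · exact h
    · exact (haAB.2 h.fst_mem).elim
  refine nonempty_iso_pathGraph_three A.coe ⟨a, haAB.1⟩ ⟨u, hu.1⟩ ⟨v, hv.1⟩
    (fun h => huv (congrArg Subtype.val h)) (hside u hu) (hside v hv) ?_ ?_
  · intro h
    exact hc.not_adj_right (hY ⟨u, hu, rfl⟩) (hY ⟨v, hv, rfl⟩) ((hadj u v).2 h.adj_sub)
  · rintro ⟨t, ht⟩
    by_cases htB : t ∈ B.verts
    · have : t ∈ A.verts ∩ B.verts := ⟨ht, htB⟩
      rw [hS] at this
      rcases this with rfl | rfl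
      · exact Or.inr (Or.inl rfl)
      · exact Or.inr (Or.inr rfl)
    · have : f t ∈ f '' (A.verts \ B.verts) := ⟨t, ⟨ht, htB⟩, rfl⟩
      rw [hx] at this
      exact Or.inl (Subtype.ext (hf this))

variable [Finite V]

/-- The critical subgraph minus a vertex of `Y` is internally `3`-connected. -/
theorem internallyThreeConnected (hc : IsCritical G X Y W) {h : V}
    (hh : h ∈ verticesOver G Y W) {T : Type*} {K : SimpleGraph T} (f : T → V)
    (hf : Function.Injective f) (hadj : ∀ a b, G.Adj (f a) (f b) ↔ K.Adj a b)
    (hrange : Set.range f = closedOver G Y W \ {h}) : InternallyThreeConnected K := by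
  have hhU : h ∈ closedOver G Y W := Or.inr hh
  have : Finite T := Finite.of_injective f hf
  have hnot : ∀ A : Set T, h ∉ f '' A := by
    rintro A ⟨c, -, hch⟩
    have : f c ∈ Set.range f := ⟨c, rfl⟩
    rw [hrange] at this
    exact this.2 hch
  have hcard : 7 ≤ Nat.card T := by
    have h1 := Set.ncard_range_of_injective hf
    have h2 := Set.ncard_sdiff_singleton_add_one hhU
    have h8 := hc.eight_le_ncard
    rw [hrange] at h1
    omega
  refine ⟨⟨by omega, fun S hS => ?_⟩, by omega, ?_⟩
  · refine hc.connected_of_range_eq (S := insert h (f '' S))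
      (fun t : (Sᶜ : Set T) => f t) (hf.comp Subtype.val_injective)
      (fun a b hab => (hadj _ _).1 hab) ?_ ?_ ?_
    · have h1 := Set.ncard_insert_le h (f '' S)
      rw [Set.ncard_image_of_injective S hf] at h1
      omega
    · refine Set.insert_subset hhU ?_
      have : f '' S ⊆ Set.range f := Set.image_subset_range f S
      rw [hrange] at this
      exact this.trans Set.sdiff_subset
    · change Set.range (f ∘ Subtype.val) = _
      rw [Set.range_comp, Subtype.range_coe, Set.image_compl_eq_range_sdiff_image hf, hrange,
        Set.sdiff_sdiff, Set.singleton_union]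
  · rintro A B ⟨-, hAB, h2, hA, hB⟩
    have hverts : A.verts ∪ B.verts = Set.univ := by
      rw [← Subgraph.verts_sup, hAB, Subgraph.verts_top]
    have hcomp : ∀ C D : Set T, 3 ≤ C.ncard → (C ∩ D).ncard = 2 → (f '' (C \ D)).Nonempty := by
      intro C D hC hCD
      have := Set.ncard_inter_add_ncard_sdiff_eq_ncard C D
      exact (Set.nonempty_of_ncard_ne_zero (by omega)).image f
    have hU : f '' (A.verts \ B.verts) ∪ f '' (B.verts \ A.verts) ∪
        insert h (f '' (A.verts ∩ B.verts)) = closedOver G Y W := by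
      rw [Set.union_insert, ← Set.image_union, ← Set.image_union]
      have : A.verts \ B.verts ∪ B.verts \ A.verts ∪ A.verts ∩ B.verts = Set.univ := by
        rw [← hverts]
        ext t
        simp only [Set.mem_union, Set.mem_sdiff, Set.mem_inter_iff]
        tauto
      rw [this, Set.image_univ, hrange, Set.insert_sdiff_singleton, Set.insert_eq_of_mem hhU]
    have hnadj : ∀ a ∈ f '' (A.verts \ B.verts), ∀ b ∈ f '' (B.verts \ A.verts),
        ¬ G.Adj a b := by
      rintro _ ⟨a, ha, rfl⟩ _ ⟨b, hb, rfl⟩ hab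
      have hK : (⊤ : K.Subgraph).Adj a b := (hadj a b).1 hab
      rw [← hAB, Subgraph.sup_adj] at hK
      rcases hK with h' | h'
      · exact hb.2 h'.snd_mem
      · exact ha.2 h'.fst_mem
    have hdis : ∀ C D : Set T, Disjoint C D → Disjoint (f '' C) (insert h (f '' D)) :=
      fun C D hCD => Set.disjoint_insert_right.2 ⟨hnot _, (Set.disjoint_image_iff hf).2 hCD⟩
    have hScard : (insert h (f '' (A.verts ∩ B.verts))).ncard = 3 := by
      rw [Set.ncard_insert_of_notMem (hnot _), Set.ncard_image_of_injective _ hf, h2]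
    obtain ⟨-, hSY, x, hx, hxadj⟩ := hc.separation hU hnadj
      ((Set.disjoint_image_iff hf).2 disjoint_sdiff_sdiff)
      (hdis _ _ (Set.disjoint_sdiff_left.mono_right Set.inter_subset_right))
      (hdis _ _ (Set.disjoint_sdiff_left.mono_right Set.inter_subset_left))
      (hcomp _ _ hA h2) (hcomp _ _ hB (by rwa [Set.inter_comm])) hScard.le
      (fun _ => ⟨h, Set.mem_insert _ _, hh.1⟩)
    have hSY' := (Set.subset_insert _ _).trans hSY
    have hxadj' : ∀ s ∈ f '' (A.verts ∩ B.verts), G.Adj x s :=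
      fun s hs => hxadj s (Set.mem_insert_of_mem _ hs)
    rcases hx with hx | hx
    · exact Or.inl (hc.nonempty_iso_path_of_side f hf hadj hAB h2 hSY' hx hxadj')
    · rw [Set.inter_comm] at h2 hSY' hxadj'
      exact Or.inr (hc.nonempty_iso_path_of_side f hf hadj (by rwa [sup_comm]) h2 hSY' hx hxadj')

/-- The critical subgraph is `3`-connected. -/
theorem kConnected_three (hc : IsCritical G X Y W) {T : Type*} {K : SimpleGraph T} (f : T → V)
    (hf : Function.Injective f) (hadj : ∀ a b, G.Adj (f a) (f b) ↔ K.Adj a b)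
    (hrange : Set.range f = closedOver G Y W) : KConnected 3 K := by
  constructor
  · have h1 := Set.ncard_range_of_injective hf
    have h8 := hc.eight_le_ncard
    rw [hrange] at h1
    omega
  · intro S hS
    refine hc.connected_of_range_eq (S := f '' S) (fun t : (Sᶜ : Set T) => f t)
      (hf.comp Subtype.val_injective) (fun a b hab => (hadj _ _).1 hab) ?_ ?_ ?_
    · rw [Set.ncard_image_of_injective S hf]
      omega
    · rw [← hrange]
      exact Set.image_subset_range f S
    · change Set.range (f ∘ Subtype.val) = _
      rw [Set.range_comp, Subtype.range_coe, Set.image_compl_eq_range_sdiff_image hf, hrange]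

end IsCritical

/-- Two vertices of `Y` with the same neighbourhood span a `K_{3,2}`-subgraph. -/
lemma exists_completeBipartite_of_ncard_eq_three {V : Type*} [Finite V] (G : SimpleGraph V)
    (X Y W : Set V) (hdisj : Disjoint X Y)
    (hbip : ∀ v w : V, G.Adj v w → (v ∈ X ∧ w ∈ Y) ∨ (v ∈ Y ∧ w ∈ X))
    (hsemi : ∀ y ∈ Y, (G.neighborSet y).ncard = 3) (hWX : W ⊆ X) (hW : W.ncard = 3)
    (h2 : 2 ≤ (verticesOver G Y W).ncard) :
    ∃ H : G.Subgraph, (H.verts ∩ X).ncard = 3 ∧ (H.verts ∩ Y).ncard = 2 ∧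
      Nonempty (H.coe ≃g completeBipartiteGraph (Fin 3) (Fin 2)) := by
  obtain ⟨Z, hZ, hZ2⟩ := Set.exists_subset_card_eq h2
  have hZY : Z ⊆ Y := fun z hz => (hZ hz).1
  have hXX : ∀ a ∈ X, ∀ b ∈ X, ¬ G.Adj a b := by
    intro a ha b hb hab
    rcases hbip a b hab with h | h
    · exact Set.disjoint_left.1 hdisj hb h.2
    · exact Set.disjoint_left.1 hdisj ha h.1
  have hYY : ∀ a ∈ Y, ∀ b ∈ Y, ¬ G.Adj a b := by
    intro a ha b hb hab
    rcases hbip a b hab with h | h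
    · exact Set.disjoint_left.1 hdisj h.1 ha
    · exact Set.disjoint_left.1 hdisj h.2 hb
  have hWZ : ∀ a ∈ W, ∀ b ∈ Z, G.Adj a b := by
    intro a ha b hb
    have heq := Set.eq_of_subset_of_ncard_le (hZ hb).2 (by rw [hW, hsemi b (hZY hb)])
    have : a ∈ G.neighborSet b := heq ▸ ha
    exact SimpleGraph.Adj.symm this
  have hWZX : (W ∪ Z) ∩ X = W := by
    rw [Set.union_inter_distrib_right, Set.inter_eq_left.2 hWX,
      (hdisj.symm.mono_left hZY).inter_eq, Set.union_empty]
  have hWZY : (W ∪ Z) ∩ Y = Z := by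
    rw [Set.union_inter_distrib_right, Set.inter_eq_left.2 hZY,
      (hdisj.mono_left hWX).inter_eq, Set.empty_union]
  refine ⟨(⊤ : G.Subgraph).induce (W ∪ Z), ?_, ?_, ?_⟩
  · rw [Subgraph.induce_verts, hWZX, hW]
  · rw [Subgraph.induce_verts, hWZY, hZ2]
  · refine nonempty_iso_completeBipartiteGraph _ (Subtype.val ⁻¹' W) (Subtype.val ⁻¹' Z)
      ((hdisj.mono hWX hZY).preimage _) ?_ ?_ ?_ (by norm_num) (by norm_num) ?_ ?_ ?_
    · ext ⟨t, ht⟩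
      simpa using ht
    · rw [Nat.card_coe_set_eq, Set.ncard_preimage_of_injective_subset_range
        Subtype.val_injective
        (Subtype.range_coe ▸ Set.subset_union_left), hW]
    · rw [Nat.card_coe_set_eq, Set.ncard_preimage_of_injective_subset_range
        Subtype.val_injective
        (Subtype.range_coe ▸ Set.subset_union_right), hZ2]
    · exact fun a ha b hb hab => hXX a (hWX ha) b (hWX hb) (Subgraph.coe_adj_sub _ a b hab)
    · exact fun a ha b hb hab => hYY a (hZY ha) b (hZY hb) (Subgraph.coe_adj_sub _ a b hab)
    · exact fun a ha b hb => ⟨a.2, b.2, hWZ a ha b hb⟩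

/-- A semi-cubic bipartite graph with `|X| ≥ 3` and `|Y| ≥ 2|X| − 4` has a
`K_{3,2}`-subgraph, or a 3-connected subgraph `H` having a vertex `h ∈ V(H) ∩ Y` such that
`H − h` is internally 3-connected. -/
theorem semicubic_bipartite_subgraph {V : Type*} [Fintype V] (G : SimpleGraph V)
    (X Y : Set V)
    (hdisj : Disjoint X Y) (hcover : X ∪ Y = Set.univ)
    (hbip : ∀ v w : V, G.Adj v w → (v ∈ X ∧ w ∈ Y) ∨ (v ∈ Y ∧ w ∈ X))
    (hsemi : ∀ y ∈ Y, (G.neighborSet y).ncard = 3)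
    (hX : 3 ≤ X.ncard) (hY : 2 * X.ncard ≤ Y.ncard + 4) :
    ∃ H : G.Subgraph,
      ((H.verts ∩ X).ncard = 3 ∧ (H.verts ∩ Y).ncard = 2 ∧
        Nonempty (H.coe ≃g completeBipartiteGraph (Fin 3) (Fin 2))) ∨
      (KConnected 3 H.coe ∧
        ∃ h ∈ H.verts ∩ Y, InternallyThreeConnected (H.deleteVerts {h}).coe) := by
  have hex : ∃ n, ∃ W ⊆ X, W.ncard = n ∧ 3 ≤ n ∧ 2 * n ≤ (verticesOver G Y W).ncard + 4 := by
    refine ⟨X.ncard, X, subset_rfl, rfl, hX, ?_⟩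
    have : verticesOver G Y X = Y := by
      refine Set.sep_eq_self_iff_mem_true.2 fun y hy z hz => ?_
      rcases hbip y z hz with h | h
      · exact (Set.disjoint_left.1 hdisj h.1 hy).elim
      · exact h.2
    rwa [this]
  classical
  obtain ⟨W, hWX, hWn, h3, hbound⟩ := Nat.find_spec hex
  have hmin := fun m => Nat.find_min hex (m := m)
  rw [← hWn] at h3 hbound hmin
  rcases h3.eq_or_lt with h3 | h4
  · obtain ⟨H, hH⟩ := exists_completeBipartite_of_ncard_eq_three G X Y W hdisj hbip hsemi hWX
      h3.symm (by omega)
    exact ⟨H, Or.inl hH⟩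
  · have hc : IsCritical G X Y W := by
      refine ⟨hdisj, hbip, hsemi, hWX, h4, hbound, fun W' hW' h3' => ?_⟩
      by_contra hlt
      exact hmin _ (Set.ncard_lt_ncard hW')
        ⟨W', hW'.subset.trans hWX, rfl, h3', by omega⟩
    obtain ⟨h, hh⟩ : (verticesOver G Y W).Nonempty :=
      Set.nonempty_of_ncard_ne_zero (by omega)
    refine ⟨(⊤ : G.Subgraph).induce (closedOver G Y W), Or.inr ⟨?_, h, ⟨Or.inr hh, hh.1⟩, ?_⟩⟩
    · refine hc.kConnected_three Subtype.val Subtype.val_injective ?_ Subtype.range_coe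
      exact fun a b => ⟨fun hab => ⟨a.2, b.2, hab⟩, fun hab => Subgraph.coe_adj_sub _ a b hab⟩
    · refine hc.internallyThreeConnected hh Subtype.val Subtype.val_injective ?_
        Subtype.range_coe
      refine fun a b => ⟨fun hab => ?_, fun hab => Subgraph.coe_adj_sub _ a b hab⟩
      exact Subgraph.deleteVerts_adj.2
        ⟨a.2.1, a.2.2, b.2.1, b.2.2, a.2.1, b.2.1, hab⟩
end

section
/- Let G be a bipartite graph with bipartition (X,Y) such that every vertex y ∈ Y has degree at least 3 in G. If |X| ≥ 3 and |Y| ≥ 2|X| − 3, then Y has a subset Z such that the subgraph of G induced by the closed neighborhood N[Z] is 3-connected. -/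
open SimpleGraph

/-- An induced subgraph is `k`-connected if it has more than `k` vertices and no set of fewer than
`k` vertices separates the remaining ones into two nonempty parts without edges between them. -/
theorem kConnected_induce_of_forall_separation {V : Type*} [Finite V] {G : SimpleGraph V}
    {k : ℕ} {U : Set V} (hU : k < U.ncard)
    (h : ∀ S C D : Set V, S.ncard < k → C ∪ D ∪ S = U → Disjoint C D → Disjoint C S →
      Disjoint D S → C.Nonempty → D.Nonempty → ∃ c ∈ C, ∃ d ∈ D, G.Adj c d) :
    KConnected k (G.induce U) := by
  refine ⟨by rwa [Nat.card_coe_set_eq], fun S hS => ?_⟩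
  have hSV : (Subtype.val '' S : Set V).ncard < k := by
    rwa [Set.ncard_image_of_injective _ Subtype.val_injective]
  have hne : Nonempty (Sᶜ : Set U) := by
    obtain ⟨v, hvU, hvS⟩ := Set.exists_mem_notMem_of_ncard_lt_ncard (hSV.trans hU)
    exact ⟨⟨⟨v, hvU⟩, fun hv => hvS ⟨_, hv, rfl⟩⟩⟩
  refine { preconnected := fun u v => ?_, nonempty := hne }
  by_contra huv
  let R : Set V := {w | ∃ (hw : w ∈ U) (hw' : (⟨w, hw⟩ : U) ∈ Sᶜ),
    ((G.induce U).induce Sᶜ).Reachable u ⟨⟨w, hw⟩, hw'⟩}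
  have hRU : R ⊆ U := fun w hw => hw.1
  have hRS : Disjoint R (Subtype.val '' S) := by
    rw [Set.disjoint_left]
    rintro w ⟨hw, hw', -⟩ ⟨s, hs, rfl⟩
    exact hw' hs
  obtain ⟨c, hc, d, hd, hcd⟩ := h (Subtype.val '' S) R ((U \ R) \ (Subtype.val '' S)) hSV
    (by
      have : (Subtype.val '' S : Set V) ⊆ U := by
        rintro _ ⟨s, -, rfl⟩
        exact s.2
      ext w
      have h1 := @this w
      have h2 := @hRU w
      simp only [Set.mem_union, Set.mem_sdiff]
      tauto)
    (Set.disjoint_left.2 fun w hw hw' => hw'.1.2 hw) hRS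
    (Set.disjoint_left.2 fun w hw hw' => hw.2 hw')
    ⟨u.1.1, u.1.2, u.2, SimpleGraph.Reachable.refl _⟩
    ⟨v.1.1, ⟨v.1.2, fun hv => huv hv.2.2⟩, by
      rintro ⟨s, hs, hsv⟩
      exact v.2 (Subtype.ext hsv ▸ hs)⟩
  obtain ⟨hcU, hcS, hc⟩ := hc
  have hdS : (⟨d, hd.1.1⟩ : U) ∈ Sᶜ := fun hdS => hd.2 ⟨_, hdS, rfl⟩
  refine hd.1.2 ⟨hd.1.1, hdS, hc.trans (SimpleGraph.Adj.reachable ?_)⟩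
  exact hcd

/-- If every vertex of `X` has at least three neighbors in `Y` and every vertex of `Y` has at least
three neighbors, all in `X`, then every nonempty set `C` with neighbors only in `C ∪ S`, where
`|S| ≤ 2`, meets both `X` and `Y`. -/
theorem exists_neighborSet_subset_and_inter_nonempty {V : Type*} [Finite V] {G : SimpleGraph V}
    {X Y S C : Set V} (hN : ∀ y ∈ Y, G.neighborSet y ⊆ X)
    (hYdeg : ∀ y ∈ Y, 3 ≤ (G.neighborSet y).ncard)
    (hXdeg : ∀ x ∈ X, 3 ≤ (G.neighborSet x ∩ Y).ncard)
    (hS : S.ncard < 3) (hCXY : C ⊆ X ∪ Y) (hC : C.Nonempty)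
    (hclosed : ∀ c ∈ C, ∀ v ∈ X ∪ Y, G.Adj c v → v ∈ C ∪ S) :
    (∃ y ∈ Y ∩ C, G.neighborSet y ⊆ X ∩ (C ∪ S)) ∧ (X ∩ C).Nonempty := by
  obtain ⟨y, hyY, hyC⟩ : (Y ∩ C).Nonempty := by
    obtain ⟨c, hc⟩ := hC
    rcases hCXY hc with hcX | hcY
    · obtain ⟨y, ⟨hcy, hyY⟩, hyS⟩ :=
        Set.exists_mem_notMem_of_ncard_lt_ncard (hS.trans_le (hXdeg c hcX))
      exact ⟨y, hyY, (hclosed c hc y (Or.inr hyY) hcy).resolve_right hyS⟩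
    · exact ⟨c, hcY, hc⟩
  obtain ⟨x, hx, hxS⟩ := Set.exists_mem_notMem_of_ncard_lt_ncard (hS.trans_le (hYdeg y hyY))
  have hsub : G.neighborSet y ⊆ X ∩ (C ∪ S) := fun v hv =>
    ⟨hN y hyY hv, hclosed y hyC v (Or.inl (hN y hyY hv)) hv⟩
  exact ⟨⟨y, ⟨hyY, hyC⟩, hsub⟩, x, hN y hyY hx, (hsub hx).2.resolve_right hxS⟩

/-- The closed neighborhood theorem for a set `Y` of vertices of degree at least three whose
neighbors all lie in a set `X` disjoint from `Y`. -/
theorem exists_kConnected_three_closed_neighborhood {V : Type*} [Finite V] (G : SimpleGraph V)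
    (X Y : Set V) (hdisj : Disjoint X Y) (hN : ∀ y ∈ Y, G.neighborSet y ⊆ X)
    (hYdeg : ∀ y ∈ Y, 3 ≤ (G.neighborSet y).ncard)
    (hX : 3 ≤ X.ncard) (hY : 2 * X.ncard ≤ Y.ncard + 3) :
    ∃ Z ⊆ Y, KConnected 3 (G.induce (Z ∪ ⋃ z ∈ Z, G.neighborSet z)) := by
  induction hn : X.ncard using Nat.strong_induction_on generalizing X Y with
  | _ n ih =>
  subst hn
  by_contra hZ
  have hsmall : ∀ X' ⊆ X, ∀ Y' ⊆ Y, X'.ncard < X.ncard → 3 ≤ X'.ncard →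
      (∀ y ∈ Y', G.neighborSet y ⊆ X') → Y'.ncard + 3 < 2 * X'.ncard := by
    intro X' hX' Y' hY' hlt h3 hN'
    by_contra hle
    obtain ⟨Z, hZY, hZc⟩ := ih _ hlt X' Y' (hdisj.mono hX' hY') hN'
      (fun y hy => hYdeg y (hY' hy)) h3 (not_lt.1 hle) rfl
    exact hZ ⟨Z, hZY.trans hY', hZc⟩
  have hXdeg : ∀ x ∈ X, 3 ≤ (G.neighborSet x ∩ Y).ncard := by
    intro x hx
    by_contra hlt
    have hdel := Set.ncard_sdiff_singleton_add_one hx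
    have hsplit := Set.ncard_inter_add_ncard_sdiff_eq_ncard Y (G.neighborSet x)
    rw [Set.inter_comm] at hsplit
    rcases hX.eq_or_lt with h3 | h4
    · have hYx : Y \ G.neighborSet x = ∅ := by
        rw [Set.sdiff_eq_empty]
        intro y hy
        have hyX : G.neighborSet y = X :=
          Set.eq_of_subset_of_ncard_le (hN y hy) (h3 ▸ hYdeg y hy)
        have hxy : x ∈ G.neighborSet y := hyX ▸ hx
        exact SimpleGraph.Adj.symm hxy
      rw [hYx, Set.ncard_empty] at hsplit
      omega
    · have := hsmall (X \ {x}) Set.sdiff_subset (Y \ G.neighborSet x) Set.sdiff_subset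
        (by omega) (by omega)
        (fun y hy v hv => ⟨hN y hy.1 hv, fun hvx => hy.2 (by
          rw [Set.mem_singleton_iff] at hvx
          subst hvx
          exact SimpleGraph.Adj.symm hv)⟩)
      omega
  refine hZ ⟨Y, subset_rfl, ?_⟩
  have hU : Y ∪ ⋃ z ∈ Y, G.neighborSet z = X ∪ Y := by
    apply Set.Subset.antisymm
    · exact Set.union_subset Set.subset_union_right
        (Set.iUnion₂_subset fun y hy => (hN y hy).trans Set.subset_union_left)
    · refine Set.union_subset (fun x hx => Or.inr ?_) Set.subset_union_left
      obtain ⟨y, hy, hyY⟩ := Set.nonempty_of_ncard_ne_zero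
        (show (G.neighborSet x ∩ Y).ncard ≠ 0 by have := hXdeg x hx; omega)
      exact Set.mem_iUnion₂.2 ⟨y, hyY, SimpleGraph.Adj.symm hy⟩
  rw [hU]
  refine kConnected_induce_of_forall_separation
    (by rw [Set.ncard_union_eq hdisj]; omega) fun S C D hS hCDS hCD hCS hDS hC hD => ?_
  by_contra! hno
  have hside : ∀ C D : Set V, C ∪ D ∪ S = X ∪ Y → Disjoint C D → Disjoint D S → C.Nonempty →
      D.Nonempty → (∀ c ∈ C, ∀ d ∈ D, ¬ G.Adj c d) →
      (Y ∩ C).ncard + 3 < 2 * (X ∩ (C ∪ S)).ncard := by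
    intro C D hCDS hCD hDS hC hD hno
    have hclosedC : ∀ c ∈ C, ∀ v ∈ X ∪ Y, G.Adj c v → v ∈ C ∪ S := by
      intro c hc v hv hcv
      rw [← hCDS] at hv
      rcases hv with (hv | hv) | hv
      · exact Or.inl hv
      · exact absurd hcv (hno c hc v hv)
      · exact Or.inr hv
    have hclosedD : ∀ d ∈ D, ∀ v ∈ X ∪ Y, G.Adj d v → v ∈ D ∪ S := by
      intro d hd v hv hdv
      rw [← hCDS] at hv
      rcases hv with (hv | hv) | hv
      · exact absurd hdv.symm (hno v hv d hd)
      · exact Or.inl hv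
      · exact Or.inr hv
    obtain ⟨⟨y, hy, hyN⟩, -⟩ := exists_neighborSet_subset_and_inter_nonempty hN hYdeg hXdeg hS
      (hCDS ▸ fun c hc => Or.inl (Or.inl hc)) hC hclosedC
    obtain ⟨-, x, hx⟩ := exists_neighborSet_subset_and_inter_nonempty hN hYdeg hXdeg hS
      (hCDS ▸ fun d hd => Or.inl (Or.inr hd)) hD hclosedD
    refine hsmall _ Set.inter_subset_left _ Set.inter_subset_left (Set.ncard_lt_ncard ?_)
      ((hYdeg y hy.1).trans (Set.ncard_le_ncard hyN))
      fun z hz v hv => ⟨hN z hz.1 hv, hclosedC z hz.2 v (Or.inl (hN z hz.1 hv)) hv⟩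
    refine ⟨Set.inter_subset_left, fun hsub => ?_⟩
    rcases (hsub hx.1).2 with hxC | hxS
    · exact Set.disjoint_left.1 hCD hxC hx.2
    · exact Set.disjoint_left.1 hDS hx.2 hxS
  have h1 := hside C D hCDS hCD hDS hC hD hno
  have h2 := hside D C (by rw [Set.union_comm D C, hCDS]) hCD.symm hCS hD hC
    fun d hd c hc hdc => hno c hc d hd hdc.symm
  have hcount : ∀ A ⊆ X ∪ Y, A.ncard = (A ∩ C).ncard + (A ∩ D).ncard + (A ∩ S).ncard := by
    intro A hA
    rw [← Set.ncard_union_eq (hCD.mono Set.inter_subset_right Set.inter_subset_right),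
      ← Set.inter_union_distrib_left, ← Set.ncard_union_eq
        ((hCS.union_left hDS).mono Set.inter_subset_right Set.inter_subset_right),
      ← Set.inter_union_distrib_left, hCDS, Set.inter_eq_left.2 hA]
  have hXc := hcount X Set.subset_union_left
  have hYc := hcount Y Set.subset_union_right
  have hXC : (X ∩ (C ∪ S)).ncard = (X ∩ C).ncard + (X ∩ S).ncard := by
    rw [Set.inter_union_distrib_left,
      Set.ncard_union_eq (hCS.mono Set.inter_subset_right Set.inter_subset_right)]
  have hXD : (X ∩ (D ∪ S)).ncard = (X ∩ D).ncard + (X ∩ S).ncard := by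
    rw [Set.inter_union_distrib_left,
      Set.ncard_union_eq (hDS.mono Set.inter_subset_right Set.inter_subset_right)]
  have hSc : (X ∩ S).ncard + (Y ∩ S).ncard ≤ S.ncard := by
    rw [← Set.ncard_union_eq (hdisj.mono Set.inter_subset_left Set.inter_subset_left)]
    exact Set.ncard_le_ncard (Set.union_subset Set.inter_subset_right Set.inter_subset_right)
  omega

/-- In a bipartite graph with every vertex of `Y` of degree at least 3,
`|X| ≥ 3` and `|Y| ≥ 2|X| − 3`, some subset `Z` of `Y` has a 3-connected closed-neighborhood
induced subgraph. -/
theorem bipartite_closed_neighborhood_three_connected {V : Type*} [Fintype V]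
    (G : SimpleGraph V) (X Y : Set V)
    (hdisj : Disjoint X Y) (hcover : X ∪ Y = Set.univ)
    (hbip : ∀ v w : V, G.Adj v w → (v ∈ X ∧ w ∈ Y) ∨ (v ∈ Y ∧ w ∈ X))
    (hdeg : ∀ y ∈ Y, 3 ≤ (G.neighborSet y).ncard)
    (hX : 3 ≤ X.ncard) (hY : 2 * X.ncard ≤ Y.ncard + 3) :
    ∃ Z ⊆ Y, KConnected 3 (G.induce (Z ∪ ⋃ z ∈ Z, G.neighborSet z)) := by
  refine exists_kConnected_three_closed_neighborhood G X Y hdisj (fun y hy v hv => ?_) hdeg hX hY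
  rcases hbip y v hv with ⟨hyX, -⟩ | ⟨-, hvX⟩
  · exact absurd hy (Set.disjoint_left.1 hdisj hyX)
  · exact hvX
end

section
/- Let G be a bipartite graph with bipartition (X,Y) such that every vertex y ∈ Y has degree at least 3 in G. If |X| ≥ 3 and |Y| ≥ 2|X| − 2, then Y has a proper subset Z such that the subgraph of G induced by the closed neighborhood N[Z] is 3-connected. -/
open SimpleGraph

/-- An induced subgraph on more than `k` vertices is `k`-connected if its vertex set cannot be
split by fewer than `k` vertices into two nonempty parts with no edges between them. -/
theorem kConnected_induce_of_no_separation {V : Type*} [Finite V] (G : SimpleGraph V) (k : ℕ)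
    (U : Set V) (hU : k < U.ncard)
    (hsep : ∀ A B P : Set V, A.Nonempty → B.Nonempty → P.ncard < k → A ∪ B ∪ P = U →
      Disjoint A B → Disjoint A P → Disjoint B P → ¬ ∀ a ∈ A, ∀ b ∈ B, ¬ G.Adj a b) :
    KConnected k (G.induce U) := by
  have hcard : Nat.card U = U.ncard := Nat.card_coe_set_eq U
  refine ⟨by omega, fun S hS => ?_⟩
  have hne : Nonempty (Sᶜ : Set U) := by
    by_contra h
    have hSu : S = Set.univ := by
      rw [Set.nonempty_coe_sort, Set.not_nonempty_iff_eq_empty, Set.compl_empty_iff] at h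
      exact h
    rw [hSu, Set.ncard_univ] at hS
    omega
  refine ⟨fun a b => ?_⟩
  by_contra hab
  let A : Set (Sᶜ : Set U) := {v | ((G.induce U).induce Sᶜ).Reachable a v}
  let ι : (Sᶜ : Set U) → V := fun v => v.1.1
  have hι : Function.Injective ι := fun x y h => Subtype.ext (Subtype.ext h)
  have hιP : ∀ T : Set (Sᶜ : Set U), Disjoint (ι '' T) (Subtype.val '' S) := by
    intro T
    rw [Set.disjoint_left]
    rintro _ ⟨v, -, rfl⟩ ⟨s, hs, hsv⟩
    exact v.2 (Subtype.ext hsv ▸ hs)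
  refine hsep (ι '' A) (ι '' Aᶜ) (Subtype.val '' S) ⟨_, a, Reachable.refl a, rfl⟩
    ⟨_, b, hab, rfl⟩ ?_ ?_ ?_ (hιP _) (hιP _) ?_
  · rwa [Set.ncard_image_of_injective _ Subtype.val_injective]
  · ext v
    constructor
    · rintro ((⟨w, -, rfl⟩ | ⟨w, -, rfl⟩) | ⟨w, -, rfl⟩)
      exacts [w.1.2, w.1.2, w.2]
    · intro hv
      by_cases hs : (⟨v, hv⟩ : U) ∈ S
      · exact Or.inr ⟨_, hs, rfl⟩
      · by_cases hA : (⟨⟨v, hv⟩, hs⟩ : (Sᶜ : Set U)) ∈ A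
        · exact Or.inl (Or.inl ⟨_, hA, rfl⟩)
        · exact Or.inl (Or.inr ⟨_, hA, rfl⟩)
  · exact (Set.disjoint_image_iff hι).2 disjoint_compl_right
  · rintro _ ⟨v, hv, rfl⟩ _ ⟨w, hw, rfl⟩ hvw
    have hadj : ((G.induce U).induce Sᶜ).Adj v w := hvw
    exact hw (Reachable.trans hv hadj.reachable)

/-- Among the sets `T ⊆ X` with at least three elements whose number of `Y`-vertices with
neighborhood inside `T` is at least `2|T| - 3`, a minimal one yields a 3-connected closed
neighborhood. -/
theorem exists_kConnected_three_of_two_mul_le {V : Type*} [Finite V]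
    (G : SimpleGraph V) (X Y : Set V) (hdisj : Disjoint X Y)
    (hN : ∀ y ∈ Y, G.neighborSet y ⊆ X)
    (hdeg : ∀ y ∈ Y, 3 ≤ (G.neighborSet y).ncard)
    (hX : 3 ≤ X.ncard) (hY : 2 * X.ncard ≤ Y.ncard + 3) :
    ∃ Z : Set V, Z ⊆ Y ∧ KConnected 3 (G.induce (Z ∪ ⋃ z ∈ Z, G.neighborSet z)) := by
  let F : Set V → Set V := fun T => {y | y ∈ Y ∧ G.neighborSet y ⊆ T}
  have hFX : F X = Y := Set.Subset.antisymm (fun y hy => hy.1) (fun y hy => ⟨hy, hN y hy⟩)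
  have hmem : X ∈ {T : Set V | T ⊆ X ∧ 3 ≤ T.ncard ∧ 2 * T.ncard ≤ (F T).ncard + 3} :=
    ⟨subset_rfl, hX, by rwa [hFX]⟩
  obtain ⟨W, -, hW⟩ := (Set.toFinite _).exists_le_minimal hmem
  obtain ⟨hWX, hW3, hWF⟩ := hW.prop
  have hsmall : ∀ T, T.ncard < 3 → (F T).ncard = 0 := by
    intro T hT
    rw [Set.ncard_eq_zero]
    refine Set.eq_empty_of_forall_notMem fun y hy => ?_
    have h1 := hdeg y hy.1
    have h2 := Set.ncard_le_ncard hy.2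
    omega
  have hbound : ∀ T, T ⊂ W → 3 ≤ T.ncard → (F T).ncard + 4 ≤ 2 * T.ncard := by
    intro T hT h3
    by_contra h
    exact hT.2 (hW.le_of_le ⟨hT.1.trans hWX, h3, by omega⟩ hT.1)
  have hcover : ⋃ z ∈ F W, G.neighborSet z = W := by
    refine Set.Subset.antisymm (Set.iUnion₂_subset fun z hz => hz.2) fun x hx => ?_
    by_contra hnot
    have hsub : F W ⊆ F (W \ {x}) := by
      refine fun y hy => ⟨hy.1, fun v hv => ⟨hy.2 hv, ?_⟩⟩
      rintro rfl
      exact hnot (Set.mem_biUnion hy hv)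
    have h1 := Set.ncard_le_ncard hsub
    have h2 := Set.ncard_sdiff_singleton_add_one hx
    have h3 := hsmall (W \ {x})
    have h4 := hbound (W \ {x}) (Set.sdiff_singleton_ssubset.2 hx)
    omega
  have hdWF : Disjoint W (F W) := hdisj.mono hWX fun y hy => hy.1
  refine ⟨F W, fun y hy => hy.1, ?_⟩
  rw [hcover]
  apply kConnected_induce_of_no_separation
  · rw [Set.ncard_union_eq hdWF.symm]
    omega
  intro A B P hA hB hP hU hAB hAP hBP hno
  have split : ∀ T ⊆ F W ∪ W, T.ncard = (T ∩ A).ncard + (T ∩ B).ncard + (T ∩ P).ncard := by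
    intro T hT
    rw [← Set.ncard_union_eq (hAB.mono Set.inter_subset_right Set.inter_subset_right),
      ← Set.inter_union_distrib_left, ← Set.ncard_union_eq
        ((Set.disjoint_union_left.2 ⟨hAP, hBP⟩).mono Set.inter_subset_right Set.inter_subset_right),
      ← Set.inter_union_distrib_left, hU, Set.inter_eq_left.2 hT]
  have hWs := split W Set.subset_union_right
  have hFs := split (F W) Set.subset_union_left
  have hPs : (W ∩ P).ncard + (F W ∩ P).ncard ≤ P.ncard := by
    rw [← Set.ncard_union_eq (hdWF.mono Set.inter_subset_left Set.inter_subset_left)]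
    exact Set.ncard_le_ncard (Set.union_subset Set.inter_subset_right Set.inter_subset_right)
  have side : ∀ C D : Set V, C.Nonempty → C ∪ D ∪ P = F W ∪ W → Disjoint C P →
      (∀ c ∈ C, ∀ d ∈ D, ¬ G.Adj c d) →
      (W ∩ C).Nonempty ∧ F W ∩ C ⊆ F (W ∩ C ∪ W ∩ P) := by
    intro C D hC hCU hCP hCD
    have hnb : ∀ y ∈ F W ∩ C, G.neighborSet y ⊆ W ∩ C ∪ W ∩ P := by
      intro y hy v hv
      have hvW := hy.1.2 hv
      have hvU : v ∈ C ∪ D ∪ P := hCU ▸ Or.inr hvW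
      rcases hvU with (h | h) | h
      · exact Or.inl ⟨hvW, h⟩
      · exact absurd hv (hCD y hy.2 v h)
      · exact Or.inr ⟨hvW, h⟩
    refine ⟨?_, fun y hy => ⟨hy.1.1, hnb y hy⟩⟩
    obtain ⟨c, hc⟩ := hC
    have hcU : c ∈ F W ∪ W := hCU ▸ Or.inl (Or.inl hc)
    rcases hcU with h | h
    · by_contra hempty
      have hsub := hnb c ⟨h, hc⟩
      rw [Set.not_nonempty_iff_eq_empty.1 hempty, Set.empty_union] at hsub
      have h1 := hdeg c h.1
      have h2 := Set.ncard_le_ncard (hsub.trans Set.inter_subset_right)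
      omega
    · exact ⟨c, h, hc⟩
  obtain ⟨hWA, hFA⟩ := side A B hA hU hAP hno
  obtain ⟨hWB, hFB⟩ := side B A hB (by rw [Set.union_comm B A, hU]) hBP
    fun b hb a ha h => hno a ha b hb h.symm
  have proper : ∀ C D : Set V, (W ∩ D).Nonempty → Disjoint C D → Disjoint D P →
      W ∩ C ∪ W ∩ P ⊂ W := by
    rintro C D ⟨d, hdW, hdD⟩ hCD hDP
    refine ⟨Set.union_subset Set.inter_subset_left Set.inter_subset_left, fun h => ?_⟩
    rcases h hdW with h | h
    · exact hCD.le_bot ⟨h.2, hdD⟩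
    · exact hDP.le_bot ⟨hdD, h.2⟩
  have hcA := Set.ncard_union_eq (hAP.mono (Set.inter_subset_right (s := W))
    (Set.inter_subset_right (s := W)))
  have hcB := Set.ncard_union_eq (hBP.mono (Set.inter_subset_right (s := W))
    (Set.inter_subset_right (s := W)))
  have hbA := hbound _ (proper A B hWB hAB hBP)
  have hbB := hbound _ (proper B A hWA hAB.symm hAP)
  have hsA := hsmall (W ∩ A ∪ W ∩ P)
  have hsB := hsmall (W ∩ B ∪ W ∩ P)
  have hlA := Set.ncard_le_ncard hFA
  have hlB := Set.ncard_le_ncard hFB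
  have hpA := (Set.ncard_pos).2 hWA
  have hpB := (Set.ncard_pos).2 hWB
  omega

/-- In a bipartite graph with every vertex of `Y` of degree at least 3,
`|X| ≥ 3` and `|Y| ≥ 2|X| − 2`, some proper subset `Z` of `Y` has a 3-connected
closed-neighborhood induced subgraph. -/
theorem bipartite_closed_neighborhood_three_connected' {V : Type*} [Fintype V]
    (G : SimpleGraph V) (X Y : Set V)
    (hdisj : Disjoint X Y) (hcover : X ∪ Y = Set.univ)
    (hbip : ∀ v w : V, G.Adj v w → (v ∈ X ∧ w ∈ Y) ∨ (v ∈ Y ∧ w ∈ X))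
    (hdeg : ∀ y ∈ Y, 3 ≤ (G.neighborSet y).ncard)
    (hX : 3 ≤ X.ncard) (hY : 2 * X.ncard ≤ Y.ncard + 2) :
    ∃ Z : Set V, Z ⊂ Y ∧ KConnected 3 (G.induce (Z ∪ ⋃ z ∈ Z, G.neighborSet z)) := by
  obtain ⟨y, hy⟩ : Y.Nonempty := Set.nonempty_of_ncard_ne_zero (by omega)
  have hcard := Set.ncard_sdiff_singleton_add_one hy
  obtain ⟨Z, hZ, hconn⟩ := exists_kConnected_three_of_two_mul_le G X (Y \ {y})
    (hdisj.mono_right Set.sdiff_subset)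
    (fun v hv w hw => (hbip v w hw).elim
      (fun h => absurd hv.1 (Set.disjoint_left.1 hdisj h.1)) And.right)
    (fun v hv => hdeg v hv.1) hX (by omega)
  exact ⟨Z, hZ.trans_ssubset (Set.sdiff_singleton_ssubset.2 hy), hconn⟩
end

section
/- Let G be a triangle-free super-minimally 3-connected graph with an edge ab such that G∖ab is internally 3-connected. Then the enhanced deletion G\\ab is 3-connected. -/
open SimpleGraph

/-- A graph is super-minimally `k`-connected if it is `k`-connected but no proper subgraph
is `k`-connected. -/
def SuperMinimallyKConnected {V : Type*} (k : ℕ) (G : SimpleGraph V) : Prop :=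
  KConnected k G ∧ ∀ H : G.Subgraph, H ≠ ⊤ → ¬ KConnected k H.coe

/-- In a triangle-free graph two neighbours of a vertex are not adjacent. -/
lemma not_adj_of_common_neighbor {V : Type*} {G : SimpleGraph V} (htf : G.CliqueFree 3)
    {u x y : V} (hx : G.Adj u x) (hy : G.Adj u y) : ¬ G.Adj x y := fun h => by
  classical
  exact htf {u, x, y} (is3Clique_triple_iff.2 ⟨hx, hy, h⟩)

/-- Two vertices separated by a set are not connected after deleting that set. -/
lemma not_connected_induce_compl {V : Type*} {G : SimpleGraph V} {S X : Set V} {x y : V}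
    (hx : x ∈ X) (hxS : x ∉ S) (hy : y ∉ X) (hyS : y ∉ S)
    (hclosed : ∀ p ∈ X, ∀ q, G.Adj p q → q ∈ X ∪ S) : ¬ (G.induce Sᶜ).Connected := by
  intro hconn
  obtain ⟨p⟩ := hconn.preconnected ⟨x, hxS⟩ ⟨y, hyS⟩
  obtain ⟨d, -, hd, hd'⟩ := p.exists_boundary_dart (Subtype.val ⁻¹' X) hx hy
  exact (hclosed _ hd _ d.adj).elim hd' d.snd.2

/-- The minimum degree of a `k`-connected graph is at least `k`. -/
lemma KConnected.le_ncard_neighborSet {V : Type*} [Finite V] {k : ℕ} {G : SimpleGraph V}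
    (h : KConnected k G) (v : V) : k ≤ (G.neighborSet v).ncard := by
  by_contra! hlt
  have hv : v ∉ G.neighborSet v := by simp
  obtain ⟨y, hy⟩ : ∃ y, y ∉ insert v (G.neighborSet v) := by
    by_contra! hall
    have huniv := Set.eq_univ_of_forall hall
    have hc := Set.ncard_insert_of_notMem hv
    rw [huniv, Set.ncard_univ] at hc
    have := h.1
    omega
  rw [Set.mem_insert_iff, not_or] at hy
  refine not_connected_induce_compl (X := {v}) rfl hv hy.1 hy.2 ?_ (h.2 _ hlt)
  rintro p rfl q hq
  exact Or.inr hq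

/-- A triangle-free 3-connected graph has at least six vertices. -/
lemma six_le_card {V : Type*} [Finite V] {G : SimpleGraph V} (htf : G.CliqueFree 3)
    (h : KConnected 3 G) {a b : V} (hab : G.Adj a b) : 6 ≤ Nat.card V := by
  have hdisj : Disjoint (G.neighborSet a) (G.neighborSet b) :=
    Set.disjoint_left.2 fun u hu hu' =>
      not_adj_of_common_neighbor htf (SimpleGraph.Adj.symm hu) (SimpleGraph.Adj.symm hu') hab
  have h1 := Set.ncard_union_eq hdisj
  have h2 := Set.ncard_le_card (G.neighborSet a ∪ G.neighborSet b)
  have := h.le_ncard_neighborSet a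
  have := h.le_ncard_neighborSet b
  omega

/-- Deleting an edge of a triangle-free 3-connected graph leaves all degrees at least three,
except that an end of the edge may be left with exactly two, nonadjacent, neighbours. -/
lemma ncard_neighborSet_deleteEdges {V : Type*} [Finite V] {G : SimpleGraph V}
    (htf : G.CliqueFree 3) (h : KConnected 3 G) {a b : V} (hab : G.Adj a b) (x : V) :
    3 ≤ ((G.deleteEdges {s(a, b)}).neighborSet x).ncard ∨ x ∈ ({a, b} : Set V) ∧
      ∃ c d, c ≠ d ∧ ¬ G.Adj c d ∧ (G.deleteEdges {s(a, b)}).neighborSet x = {c, d} := by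
  have hx := h.le_ncard_neighborSet x
  by_cases hxab : x ∈ ({a, b} : Set V)
  · refine or_iff_not_imp_left.2 fun hlt => ⟨hxab, ?_⟩
    obtain ⟨y, hxy⟩ : ∃ y, s(x, y) = s(a, b) := by
      rcases hxab with rfl | rfl
      · exact ⟨b, rfl⟩
      · exact ⟨a, Sym2.eq_swap⟩
    have hadj : G.Adj x y := by rw [← mem_edgeSet, hxy]; exact hab
    have hset : (G.deleteEdges {s(a, b)}).neighborSet x = G.neighborSet x \ {y} := by
      ext u
      simp [← hxy, deleteEdges_adj]
      grind [SimpleGraph.Adj.ne]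
    have hcard := Set.ncard_sdiff_singleton_add_one (s := G.neighborSet x) hadj
    rw [← hset] at hcard
    obtain ⟨c, d, hcd, hN⟩ := Set.ncard_eq_two.1
      (show ((G.deleteEdges {s(a, b)}).neighborSet x).ncard = 2 by omega)
    refine ⟨c, d, hcd, ?_, hN⟩
    have hc : c ∈ (G.deleteEdges {s(a, b)}).neighborSet x := by simp [hN]
    have hd : d ∈ (G.deleteEdges {s(a, b)}).neighborSet x := by simp [hN]
    rw [hset] at hc hd
    exact not_adj_of_common_neighbor htf hc.1 hd.1
  · left
    have hset : (G.deleteEdges {s(a, b)}).neighborSet x = G.neighborSet x := by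
      ext u
      simp only [mem_neighborSet, deleteEdges_adj, Set.mem_singleton_iff, and_iff_left_iff_imp]
      rintro - hu
      exact hxab (Sym2.mem_iff.1 (hu ▸ Sym2.mem_mk_left x u))
    rwa [hset]

/-- In an internally 3-connected graph, a separating set with at most two vertices has a side
consisting of a single vertex. -/
lemma InternallyThreeConnected.side_eq_singleton {V : Type*} [Finite V] {G : SimpleGraph V}
    (hG : InternallyThreeConnected G) {S X Y : Set V} (hS : S.ncard < 3)
    (hSX : Disjoint S X) (hSY : Disjoint S Y) (hXY : Disjoint X Y)
    (hcover : ∀ v, v ∈ S ∨ v ∈ X ∨ v ∈ Y) (hX : X.Nonempty) (hY : Y.Nonempty)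
    (hno : ∀ x ∈ X, ∀ y ∈ Y, ¬ G.Adj x y) : X.ncard = 1 ∨ Y.ncard = 1 := by
  have hS2 : S.ncard = 2 := by
    by_contra hne
    obtain ⟨x, hx⟩ := hX
    obtain ⟨y, hy⟩ := hY
    refine not_connected_induce_compl hx (Set.disjoint_right.1 hSX hx)
      (Set.disjoint_right.1 hXY hy) (Set.disjoint_right.1 hSY hy) ?_ (hG.1.2 S (by omega))
    intro p hp q hpq
    rcases hcover q with h | h | h
    · exact Or.inr h
    · exact Or.inl h
    · exact absurd hpq (hno p hp q h)
  let A : G.Subgraph := (⊤ : G.Subgraph).induce (S ∪ X)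
  let B : G.Subgraph :=
    { verts := S ∪ Y
      Adj := fun u v => G.Adj u v ∧ u ∈ S ∪ Y ∧ v ∈ S ∪ Y ∧ (u ∈ Y ∨ v ∈ Y)
      adj_sub := fun h => h.1
      edge_vert := fun h => h.2.1
      symm := ⟨fun u v h => ⟨h.1.symm, h.2.2.1, h.2.1, h.2.2.2.symm⟩⟩ }
  have hAc : A.verts.ncard = 2 + X.ncard := by
    rw [← hS2]; exact Set.ncard_union_eq hSX
  have hBc : B.verts.ncard = 2 + Y.ncard := by
    rw [← hS2]; exact Set.ncard_union_eq hSY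
  have hsep : IsKSeparation 2 G A B := by
    have hX' := (Set.ncard_pos).2 hX
    have hY' := (Set.ncard_pos).2 hY
    refine ⟨?_, ?_, ?_, by omega, by omega⟩
    · rw [Set.disjoint_left]
      intro e
      induction e using Sym2.ind with | _ u v
      rintro ⟨hu, hv, -⟩ ⟨-, -, -, h⟩
      have hnot : ∀ w ∈ S ∪ X, w ∉ Y := fun w hw hw' =>
        hw.elim (Set.disjoint_right.1 hSY hw') (Set.disjoint_right.1 hXY hw')
      exact h.elim (hnot u hu) (hnot v hv)
    · ext u v
      · have := hcover u
        simp only [A, B, Subgraph.verts_sup, Subgraph.induce_verts, Set.mem_union,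
          Subgraph.verts_top, Set.mem_univ, iff_true]
        tauto
      · simp only [A, B, Subgraph.sup_adj, Subgraph.induce_adj, Subgraph.top_adj, Set.mem_union]
        have := hcover u
        have := hcover v
        have := hno u
        have := hno v
        have := G.adj_comm u v
        grind
    · rw [← hS2]
      congr 1
      change (S ∪ X) ∩ (S ∪ Y) = S
      rw [← Set.union_inter_distrib_left, hXY.inter_eq, Set.union_empty]
  have hiso : ∀ C : G.Subgraph, Nonempty (C.coe ≃g pathGraph 3) → C.verts.ncard = 3 := by
    rintro C ⟨φ⟩
    rw [← Nat.card_coe_set_eq, Nat.card_congr φ.toEquiv, Nat.card_fin]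
  rcases hG.2.2 A B hsep with h | h
  · left
    have := hiso A h
    omega
  · right
    have := hiso B h
    omega

/-- Let `H` arise from an internally 3-connected graph `G` by removing an independent set of
vertices and making the neighbourhood of each of them a clique. If `H` has at least four
vertices, and all of them have degree at least three in `G`, then `H` is 3-connected. -/
lemma kConnected_three_of_suppress {V W : Type*} [Finite V] {G : SimpleGraph V}
    {H : SimpleGraph W} (hG : InternallyThreeConnected G) (f : W → V)
    (hf : Function.Injective f) (hcard : 3 < Nat.card W)
    (hadj : ∀ u v, G.Adj (f u) (f v) → H.Adj u v)
    (hind : ∀ t u, t ∉ Set.range f → G.Adj t u → u ∈ Set.range f)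
    (hclique : ∀ t u v, t ∉ Set.range f → G.Adj t (f u) → G.Adj t (f v) → u ≠ v → H.Adj u v)
    (hdeg : ∀ w, 3 ≤ (G.neighborSet (f w)).ncard) : KConnected 3 H := by
  have : Finite W := Finite.of_injective f hf
  refine ⟨hcard, fun S hS => ?_⟩
  have hne : Nonempty (Sᶜ : Set W) := by
    rw [Set.nonempty_coe_sort, Set.nonempty_compl]
    rintro rfl
    rw [Set.ncard_univ] at hS
    omega
  refine ⟨fun u v => ?_⟩
  by_contra huv
  let R : Set W := Subtype.val '' {x : (Sᶜ : Set W) | (H.induce Sᶜ).Reachable u x}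
  have hRS : ∀ x ∈ R, x ∉ S := by
    rintro _ ⟨x, -, rfl⟩
    exact x.2
  have hR : ∀ x ∈ R, ∀ y, H.Adj x y → y ∉ S → y ∈ R := by
    rintro _ ⟨x, hx, rfl⟩ y hxy hy
    exact ⟨⟨y, hy⟩, Reachable.trans hx (Adj.reachable (by exact hxy)), rfl⟩
  have huR : u.1 ∈ R := ⟨u, Reachable.refl u, rfl⟩
  have hvR : v.1 ∉ R := by
    rintro ⟨x, hx, hxv⟩
    exact huv (Subtype.ext hxv ▸ hx)
  let X : Set V := f '' R ∪ {t | t ∉ Set.range f ∧ ∃ x ∈ R, G.Adj t (f x)}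
  have hfX : ∀ w, f w ∈ X ↔ w ∈ R := by
    intro w
    simp [X, hf.mem_set_image]
  have hfS : ∀ w, f w ∈ f '' S ↔ w ∈ S := fun w => hf.mem_set_image
  have hSX : Disjoint (f '' S) X := by
    rw [Set.disjoint_left]
    rintro _ ⟨s, hs, rfl⟩ h
    exact hRS s ((hfX s).1 h) hs
  have hS' : (f '' S).ncard < 3 := by rwa [Set.ncard_image_of_injective S hf]
  have huX : f u ∈ X := (hfX _).2 huR
  have hvY : f v ∈ (f '' S ∪ X)ᶜ := by
    rintro (h | h)
    · exact v.2 ((hfS _).1 h)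
    · exact hvR ((hfX _).1 h)
  have hno : ∀ p ∈ X, ∀ q ∈ (f '' S ∪ X)ᶜ, ¬ G.Adj p q := by
    intro p hp q hq hpq
    rw [Set.mem_compl_iff, Set.mem_union, not_or] at hq
    obtain ⟨hqS, hqX⟩ := hq
    by_cases hqr : q ∈ Set.range f
    · obtain ⟨y, rfl⟩ := hqr
      rw [hfS] at hqS
      rw [hfX] at hqX
      rcases hp with ⟨x, hx, rfl⟩ | ⟨hp, x, hx, hpx⟩
      · exact hqX (hR x hx y (hadj _ _ hpq) hqS)
      · exact hqX (hR x hx y (hclique p x y hp hpx hpq (by rintro rfl; exact hqX hx)) hqS)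
    · rcases hp with ⟨x, hx, rfl⟩ | ⟨hp, -⟩
      · exact hqX (Or.inr ⟨hqr, x, hx, hpq.symm⟩)
      · exact hqr (hind p q hp hpq)
  have hlarge : ∀ (w : W), ¬ G.neighborSet (f w) ⊆ f '' S := fun w hw => by
    have := Set.ncard_le_ncard hw
    have := hdeg w
    omega
  rcases hG.side_eq_singleton hS' hSX
    (disjoint_compl_right.mono_left Set.subset_union_left)
    (disjoint_compl_right.mono_left Set.subset_union_right)
    (fun x => by by_cases x ∈ f '' S <;> by_cases x ∈ X <;> simp_all) ⟨_, huX⟩ ⟨_, hvY⟩ hno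
    with h | h
  · obtain ⟨x, hx⟩ := Set.ncard_eq_one.1 h
    refine hlarge u fun q hq => ?_
    by_contra hqS
    have hqX : q ∈ X := by
      by_contra hqX
      exact hno _ huX q (fun h => h.elim hqS hqX) hq
    rw [hx] at hqX huX
    exact G.ne_of_adj hq (huX.trans hqX.symm)
  · obtain ⟨x, hx⟩ := Set.ncard_eq_one.1 h
    refine hlarge v fun q hq => ?_
    by_contra hqS
    have hqX : q ∈ (f '' S ∪ X)ᶜ := fun h =>
      h.elim hqS fun hqX => hno q hqX _ hvY (Adj.symm hq)
    rw [hx] at hqX hvY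
    exact G.ne_of_adj hq (hvY.trans hqX.symm)

/-- Let `G` be a triangle-free super-minimally 3-connected graph with an edge
`ab` such that `G∖ab` is internally 3-connected.  Then the enhanced deletion `G\\ab` is
3-connected.  The conclusion is stated case-by-case following the definition of the enhanced
deletion: case (i) both endpoints have exactly two (nonadjacent) neighbours in `G∖ab` and the
two pairs are disjoint; case (ii) exactly one endpoint has this property; case (iii) all other
cases, where `G\\ab = G∖ab`. -/
theorem enhanced_deletion_three_connected {V : Type*} [Fintype V] (G : SimpleGraph V)
    (htf : G.CliqueFree 3) (hsm : SuperMinimallyKConnected 3 G)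
    (a b : V) (hab : G.Adj a b)
    (hint : InternallyThreeConnected (G.deleteEdges {s(a, b)})) :
    -- case (i)
    ((∀ c d e f : V, c ≠ d → e ≠ f → ¬ G.Adj c d → ¬ G.Adj e f →
        (G.deleteEdges {s(a, b)}).neighborSet a = {c, d} →
        (G.deleteEdges {s(a, b)}).neighborSet b = {e, f} →
        ({c, d} ∩ {e, f} : Set V) = ∅ →
        KConnected 3
          ((G ⊔ fromEdgeSet {s(c, d), s(e, f)}).induce ({a, b}ᶜ : Set V))) ∧
    -- case (ii)
    (∀ z w c d : V, s(z, w) = s(a, b) → c ≠ d → ¬ G.Adj c d →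
        (G.deleteEdges {s(a, b)}).neighborSet z = {c, d} →
        ¬ (∃ e f : V, e ≠ f ∧ ¬ G.Adj e f ∧
            (G.deleteEdges {s(a, b)}).neighborSet w = {e, f}) →
        KConnected 3 ((G ⊔ fromEdgeSet {s(c, d)}).induce ({z}ᶜ : Set V))) ∧
    -- case (iii)
    ((¬ ∃ c d e f : V, c ≠ d ∧ e ≠ f ∧ ¬ G.Adj c d ∧ ¬ G.Adj e f ∧
        (G.deleteEdges {s(a, b)}).neighborSet a = {c, d} ∧
        (G.deleteEdges {s(a, b)}).neighborSet b = {e, f} ∧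
        ({c, d} ∩ {e, f} : Set V) = ∅) →
      (¬ ∃ z w c d : V, s(z, w) = s(a, b) ∧ c ≠ d ∧ ¬ G.Adj c d ∧
        (G.deleteEdges {s(a, b)}).neighborSet z = {c, d} ∧
        ¬ (∃ e f : V, e ≠ f ∧ ¬ G.Adj e f ∧
            (G.deleteEdges {s(a, b)}).neighborSet w = {e, f})) →
      KConnected 3 (G.deleteEdges {s(a, b)}))) := by
  have hdeg := ncard_neighborSet_deleteEdges htf hsm.1 hab
  have hcard := six_le_card htf hsm.1 hab
  have hirr : ∀ {x y}, (G.deleteEdges {s(a, b)}).Adj x y → G.Adj x y := fun h =>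
    (deleteEdges_le _) h
  refine ⟨?_, ?_, ?_⟩
  · intro c d e f hcd hef hGcd hGef ha hb hdisj
    have hna : ∀ u, (G.deleteEdges {s(a, b)}).Adj a u ↔ u = c ∨ u = d := fun u => by
      rw [← mem_neighborSet, ha]; simp
    have hnb : ∀ u, (G.deleteEdges {s(a, b)}).Adj b u ↔ u = e ∨ u = f := fun u => by
      rw [← mem_neighborSet, hb]; simp
    refine kConnected_three_of_suppress hint Subtype.val Subtype.val_injective ?_ ?_ ?_ ?_ ?_
    · rw [Nat.card_coe_set_eq]
      have := Set.ncard_add_ncard_compl ({a, b} : Set V)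
      have := Set.ncard_pair hab.ne
      omega
    · rintro ⟨u, hu⟩ ⟨v, hv⟩ h
      exact Or.inl (hirr h)
    · intro t u ht hu
      have ht' : t = a ∨ t = b := by simpa [or_iff_not_imp_left] using ht
      have hu1 : u ≠ t := by rintro rfl; exact hu.ne rfl
      have hu2 : s(t, u) ≠ s(a, b) := fun h => by simp [deleteEdges_adj, h] at hu
      simp only [Subtype.range_coe_subtype, Set.mem_ofPred_eq, Set.mem_compl_iff,
        Set.mem_insert_iff, Set.mem_singleton_iff, not_or]
      rcases ht' with rfl | rfl
      · exact ⟨hu1, fun h => hu2 (by rw [h])⟩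
      · exact ⟨fun h => hu2 (by rw [h, Sym2.eq_swap]), hu1⟩
    · rintro t ⟨u, hu⟩ ⟨v, hv⟩ ht htu htv huv
      have ht' : t = a ∨ t = b := by simpa [or_iff_not_imp_left] using ht
      have huv' : u ≠ v := fun h => huv (Subtype.ext h)
      refine Or.inr ?_
      rw [fromEdgeSet_adj]
      refine ⟨?_, huv'⟩
      rcases ht' with rfl | rfl
      · rcases (hna u).1 htu with rfl | rfl <;> rcases (hna v).1 htv with rfl | rfl <;>
          simp_all [Sym2.eq_swap]
      · rcases (hnb u).1 htu with rfl | rfl <;> rcases (hnb v).1 htv with rfl | rfl <;>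
          simp_all [Sym2.eq_swap]
    · rintro ⟨w, hw⟩
      rcases hdeg w with h | ⟨h, -⟩
      · exact h
      · exact absurd h hw
  · intro z w c d hzw hcd hGcd hz hw
    have hnz : ∀ u, (G.deleteEdges {s(a, b)}).Adj z u ↔ u = c ∨ u = d := fun u => by
      rw [← mem_neighborSet, hz]; simp
    refine kConnected_three_of_suppress hint Subtype.val Subtype.val_injective ?_ ?_ ?_ ?_ ?_
    · rw [Nat.card_coe_set_eq]
      have := Set.ncard_add_ncard_compl ({z} : Set V)
      have := Set.ncard_singleton z
      omega
    · rintro ⟨u, hu⟩ ⟨v, hv⟩ h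
      exact Or.inl (hirr h)
    · intro t u ht hu
      have ht' : t = z := by simpa using ht
      subst ht'
      simpa using hu.ne'
    · rintro t ⟨u, hu⟩ ⟨v, hv⟩ ht htu htv huv
      have ht' : t = z := by simpa using ht
      subst ht'
      have huv' : u ≠ v := fun h => huv (Subtype.ext h)
      refine Or.inr ?_
      rw [fromEdgeSet_adj]
      refine ⟨?_, huv'⟩
      rcases (hnz u).1 htu with rfl | rfl <;> rcases (hnz v).1 htv with rfl | rfl <;>
        simp_all [Sym2.eq_swap]
    · rintro ⟨x, hx⟩
      rcases hdeg x with h | ⟨h, hx'⟩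
      · exact h
      · have : x = w := by
          rcases Sym2.eq_iff.1 hzw with ⟨rfl, rfl⟩ | ⟨rfl, rfl⟩ <;> simp_all
        exact absurd (this ▸ hx') hw
  · intro h1 h2
    refine kConnected_three_of_suppress hint id Function.injective_id (by omega)
      (fun _ _ h => h) (fun t _ ht => absurd ⟨t, rfl⟩ ht) (fun t _ _ ht => absurd ⟨t, rfl⟩ ht) ?_
    by_contra! hlow
    obtain ⟨x, hx⟩ := hlow
    obtain ⟨hxab, c, d, hcd, hGcd, hxn⟩ := (hdeg x).resolve_left (by simpa using hx)
    obtain ⟨y, hxy⟩ : ∃ y, s(x, y) = s(a, b) := by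
      rcases hxab with rfl | rfl
      · exact ⟨b, rfl⟩
      · exact ⟨a, Sym2.eq_swap⟩
    refine h2 ⟨x, y, c, d, hxy, hcd, hGcd, hxn, ?_⟩
    rintro ⟨e, f, hef, hGef, hyn⟩
    have hdisj : ({c, d} ∩ {e, f} : Set V) = ∅ := by
      rw [← hxn, ← hyn, Set.eq_empty_iff_forall_notMem]
      rintro u ⟨hu, hu'⟩
      have hGxy : G.Adj x y := by rw [← mem_edgeSet, hxy]; exact hab
      exact not_adj_of_common_neighbor htf (hirr hu).symm (hirr hu').symm hGxy
    rcases Sym2.eq_iff.1 hxy with ⟨rfl, rfl⟩ | ⟨rfl, rfl⟩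
    · exact h1 ⟨c, d, e, f, hcd, hef, hGcd, hGef, hxn, hyn, hdisj⟩
    · exact h1 ⟨e, f, c, d, hef, hcd, hGef, hGcd, hyn, hxn, by rwa [Set.inter_comm]⟩
end
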